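/- arXiv:1808.03932 — 6 statements merged into one kernel-verified Lean document; each statement's English description precedes it below -/
import Mathlib

section
/- Let G be a finite simple graph with nonempty vertex set X and let t₀ = ω(G). Then the sequence (m_n) of the partially commutative monoid M(X,G) satisfies, for every n ≥ 1, the linear recurrence m_n = c_1(G) m_{n−1} − c_2(G) m_{n−2} + … + (−1)^{t₀+1} c_{t₀}(G) m_{n−t₀}, with the conventions m_0 = 1 and m_j = 0 for j < 0. -/
noncomputable section

/-- The number of cliques of size `k` in `G` (the empty set is the unique clique of size 0). -/
def cliqueCount {V : Type*} [Fintype V] (G : SimpleGraph V) (k : ℕ) : ℕ :=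
  Nat.card {s : Finset V // G.IsNClique k s}

/-- The clique number `ω(G)` of `G`. -/
def cliqueNum {V : Type*} [Fintype V] (G : SimpleGraph V) : ℕ :=
  sSup {k : ℕ | ∃ s : Finset V, G.IsNClique k s}

/-- The congruence on the free monoid on the vertices of `G` generated by the
relations `xy = yx` for every edge `(x,y)` of `G`. -/
def traceCon {V : Type*} (G : SimpleGraph V) : Con (FreeMonoid V) :=
  conGen (fun a b => ∃ x y : V, G.Adj x y ∧
    a = FreeMonoid.of x * FreeMonoid.of y ∧ b = FreeMonoid.of y * FreeMonoid.of x)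

/-- `mcount G n` is the number of elements of the partially commutative monoid `M(X,G)`
of length `n`, i.e. the number of equivalence classes containing a word of length `n`. -/
def mcount {V : Type*} [Fintype V] (G : SimpleGraph V) (n : ℕ) : ℕ :=
  Nat.card {q : (traceCon G).Quotient //
    ∃ w : FreeMonoid V, w.length = n ∧ (traceCon G).mk' w = q}

/-- The partially commutative monoid of `G`. -/
abbrev TraceMonoid {V : Type*} (G : SimpleGraph V) : Type _ := (traceCon G).Quotient

namespace TraceMonoid

open scoped Classical in
/-- Prepending the letter `y` to a trace `p.1`, while keeping track in `p.2` of the result of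
removing a leading letter `x` from that trace. -/
def consStep {V : Type*} (G : SimpleGraph V) (x y : V) :
    Function.End (TraceMonoid G × Option (TraceMonoid G)) := fun p =>
  ((traceCon G).mk' (FreeMonoid.of y) * p.1,
    if y = x then some p.1
    else if G.Adj y x then p.2.map ((traceCon G).mk' (FreeMonoid.of y) * ·) else none)

variable {V : Type*} {G : SimpleGraph V}

/-- The image of a vertex in the trace monoid. -/
def of (G : SimpleGraph V) (x : V) : TraceMonoid G := (traceCon G).mk' (FreeMonoid.of x)

theorem of_mul_of_comm {x y : V} (h : G.Adj x y) : of G x * of G y = of G y * of G x := by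
  rw [of, of, ← map_mul, ← map_mul]
  exact (Con.eq _).2 (ConGen.Rel.of _ _ ⟨x, y, h, rfl, rfl⟩)

@[elab_as_elim]
theorem induction_on {p : TraceMonoid G → Prop} (q : TraceMonoid G) (one : p 1)
    (of_mul : ∀ x q, p q → p (of G x * q)) : p q := by
  obtain ⟨w, rfl⟩ := Con.mk'_surjective q
  induction w using FreeMonoid.inductionOn' with
  | one => rwa [map_one]
  | of_mul x w ih => rw [map_mul]; exact of_mul _ _ ih

theorem consStep_comm (x : V) {y z : V} (h : G.Adj y z) :
    consStep G x y * consStep G x z = consStep G x z * consStep G x y := by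
  have hc : ∀ q : TraceMonoid G, of G y * (of G z * q) = of G z * (of G y * q) := fun q => by
    rw [← mul_assoc, of_mul_of_comm h, mul_assoc]
  have hne := h.ne
  have hs := h.symm
  funext ⟨q, o⟩
  change (of G y * (of G z * q), _) = (of G z * (of G y * q), _)
  refine Prod.ext (hc q) ?_
  simp only [consStep]
  by_cases hy : y = x
  · subst hy
    simp [hs, hne.symm]
  · by_cases hz : z = x
    · subst hz
      simp [h, hne]
    · by_cases hyx : G.Adj y x <;> by_cases hzx : G.Adj z x <;>
        simp only [hy, hz, hyx, hzx, if_true, if_false, Option.map_none]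
      cases o with
      | none => rfl
      | some r => exact congrArg some (hc r)

/-- The action of traces by `consStep`. -/
def consHom (G : SimpleGraph V) (x : V) :
    TraceMonoid G →* Function.End (TraceMonoid G × Option (TraceMonoid G)) :=
  (traceCon G).lift (FreeMonoid.lift (consStep G x)) <| by
    refine Con.conGen_le.2 ?_
    rintro _ _ ⟨y, z, h, rfl, rfl⟩
    rw [Con.ker_rel, map_mul, map_mul]
    simp only [FreeMonoid.lift_eval_of]
    exact consStep_comm x h

theorem consHom_of_mul (x y : V) (q : TraceMonoid G) (p) :
    consHom G x (of G y * q) p = consStep G x y (consHom G x q p) := by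
  rw [map_mul]; rfl

/-- Removal of a leading letter `x` from a trace, where possible. -/
def removeLeading (x : V) (q : TraceMonoid G) : Option (TraceMonoid G) :=
  (consHom G x q (1, none)).2

theorem consHom_fst (x : V) (q : TraceMonoid G) : (consHom G x q (1, none)).1 = q := by
  induction q using induction_on with
  | one => rw [map_one]; rfl
  | of_mul y q ih =>
    rw [consHom_of_mul]
    change of G y * _ = _
    rw [ih]

theorem removeLeading_one (x : V) : removeLeading x (1 : TraceMonoid G) = none := by
  rw [removeLeading, map_one]; rfl

theorem removeLeading_of_mul_self (x : V) (q : TraceMonoid G) :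
    removeLeading x (of G x * q) = some q := by
  rw [removeLeading, consHom_of_mul, consStep, consHom_fst]
  simp

theorem removeLeading_of_mul_of_adj {x y : V} (h : G.Adj y x) (q : TraceMonoid G) :
    removeLeading x (of G y * q) = (removeLeading x q).map (of G y * ·) := by
  rw [removeLeading, consHom_of_mul, consStep]
  simp only [h.ne, h, if_true, if_false]
  rfl

theorem removeLeading_of_mul_of_not_adj {x y : V} (hne : y ≠ x) (h : ¬ G.Adj y x)
    (q : TraceMonoid G) : removeLeading x (of G y * q) = none := by
  rw [removeLeading, consHom_of_mul, consStep]
  simp only [hne, h, if_false]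

theorem removeLeading_eq_some {x : V} {q r : TraceMonoid G} :
    removeLeading x q = some r ↔ q = of G x * r := by
  refine ⟨fun h => ?_, fun h => h ▸ removeLeading_of_mul_self x r⟩
  induction q using induction_on generalizing r with
  | one => simp [removeLeading_one] at h
  | of_mul y q ih =>
    by_cases hy : y = x
    · subst hy
      rw [removeLeading_of_mul_self] at h
      rw [Option.some.inj h]
    · by_cases ha : G.Adj y x
      · rw [removeLeading_of_mul_of_adj ha, Option.map_eq_some_iff] at h
        obtain ⟨s, hs, rfl⟩ := h
        rw [ih hs, ← mul_assoc, of_mul_of_comm ha, mul_assoc]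
      · simp [removeLeading_of_mul_of_not_adj hy ha] at h

theorem of_mul_injective (x : V) : Function.Injective (of G x * ·) := fun q r h => by
  have := removeLeading_of_mul_self x q
  rw [show of G x * q = of G x * r from h, removeLeading_of_mul_self] at this
  exact (Option.some.inj this).symm

theorem of_dvd_iff {x : V} {q : TraceMonoid G} :
    of G x ∣ q ↔ (removeLeading x q).isSome := by
  simp only [Option.isSome_iff_exists, removeLeading_eq_some]; rfl

theorem of_dvd_of_mul_iff {x y : V} (h : G.Adj y x) {q : TraceMonoid G} :
    of G x ∣ of G y * q ↔ of G x ∣ q := by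
  simp [of_dvd_iff, removeLeading_of_mul_of_adj h]

theorem adj_of_dvd {x y : V} {q : TraceMonoid G} (hne : y ≠ x) (hx : of G x ∣ q)
    (hy : of G y ∣ q) : G.Adj y x := by
  obtain ⟨r, rfl⟩ := hy
  by_contra h
  simp [of_dvd_iff, removeLeading_of_mul_of_not_adj hne h] at hx

/-- The length of a trace. -/
def length (G : SimpleGraph V) : TraceMonoid G →* Multiplicative ℕ :=
  (traceCon G).lift (FreeMonoid.lift fun _ => Multiplicative.ofAdd 1) <| by
    refine Con.conGen_le.2 ?_
    rintro _ _ ⟨y, z, h, rfl, rfl⟩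
    rw [Con.ker_rel, map_mul, map_mul, mul_comm]

theorem length_mk' (w : FreeMonoid V) :
    length G ((traceCon G).mk' w) = Multiplicative.ofAdd w.length := by
  induction w using FreeMonoid.inductionOn' with
  | one => rw [map_one, map_one]; rfl
  | of_mul x w ih => rw [map_mul, map_mul, ih, FreeMonoid.length_mul, ofAdd_add]; rfl

theorem length_of_mul (x : V) (q : TraceMonoid G) :
    (length G (of G x * q)).toAdd = (length G q).toAdd + 1 := by
  rw [map_mul, toAdd_mul, of, length_mk', add_comm]; rfl

theorem exists_length_iff {n : ℕ} {q : TraceMonoid G} :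
    (∃ w : FreeMonoid V, w.length = n ∧ (traceCon G).mk' w = q) ↔ (length G q).toAdd = n := by
  constructor
  · rintro ⟨w, rfl, rfl⟩
    rw [length_mk']; rfl
  · obtain ⟨w, rfl⟩ := Con.mk'_surjective q
    rintro rfl
    exact ⟨w, by rw [length_mk']; rfl, rfl⟩

theorem exists_of_dvd {q : TraceMonoid G} (h : (length G q).toAdd ≠ 0) :
    ∃ x, of G x ∣ q := by
  induction q using induction_on with
  | one => simp at h
  | of_mul x q _ => exact ⟨x, dvd_mul_right _ _⟩

variable [Fintype V]

theorem finite_length_eq (n : ℕ) : {q : TraceMonoid G | (length G q).toAdd = n}.Finite := by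
  refine ((List.finite_length_eq V n).image
    fun l => (traceCon G).mk' (FreeMonoid.ofList l)).subset fun q hq => ?_
  obtain ⟨w, hw, rfl⟩ := exists_length_iff.2 hq
  exact ⟨w.toList, hw, rfl⟩

/-- The finite set of traces of length `n`. -/
def ofLength (G : SimpleGraph V) (n : ℕ) : Finset (TraceMonoid G) :=
  (finite_length_eq n).toFinset

theorem mem_ofLength {n : ℕ} {q : TraceMonoid G} :
    q ∈ ofLength G n ↔ (length G q).toAdd = n := by
  simp [ofLength]

theorem mcount_eq_card (n : ℕ) : mcount G n = (ofLength G n).card := by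
  rw [mcount, ← Nat.card_eq_finsetCard]
  exact Nat.card_congr (Equiv.subtypeEquivRight fun q => by
    rw [exists_length_iff, mem_ofLength])

open scoped Classical in
theorem card_filter_forall_dvd {s : Finset V} (hs : G.IsClique s) (n : ℕ) :
    ((ofLength G n).filter fun q => ∀ x ∈ s, of G x ∣ q).card =
      if s.card ≤ n then mcount G (n - s.card) else 0 := by
  induction s using Finset.induction_on generalizing n with
  | empty => simp [mcount_eq_card]
  | insert a s ha ih =>
    have hcl : G.IsClique (s : Set V) := hs.subset (by simp)
    have hadj : ∀ x ∈ s, G.Adj a x := fun x hx =>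
      hs (by simp) (by simp [hx]) (by rintro rfl; exact ha hx)
    rw [Finset.card_insert_of_notMem ha]
    cases n with
    | zero =>
      simp only [Nat.le_zero, Nat.add_eq_zero_iff, one_ne_zero, and_false, if_false,
        Finset.card_eq_zero, Finset.filter_eq_empty_iff]
      intro q hq h
      obtain ⟨r, rfl⟩ := h a (by simp)
      rw [mem_ofLength, length_of_mul] at hq
      omega
    | succ n =>
      simp only [Nat.add_le_add_iff_right, Nat.add_sub_add_right]
      rw [← ih hcl n,
        ← Finset.card_image_of_injective ((ofLength G n).filter _) (of_mul_injective a)]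
      congr 1
      ext q
      simp only [Finset.mem_filter, Finset.mem_image, mem_ofLength, Finset.mem_insert,
        forall_eq_or_imp]
      constructor
      · rintro ⟨hl, ⟨r, rfl⟩, h⟩
        rw [length_of_mul] at hl
        exact ⟨r, ⟨by omega, fun x hx => (of_dvd_of_mul_iff (hadj x hx)).1 (h x hx)⟩, rfl⟩
      · rintro ⟨r, ⟨hl, h⟩, rfl⟩
        exact ⟨by rw [length_of_mul, hl], dvd_mul_right _ _,
          fun x hx => (of_dvd_of_mul_iff (hadj x hx)).2 (h x hx)⟩

open scoped Classical in
theorem sum_isClique_eq_zero {n : ℕ} (hn : n ≠ 0) :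
    ∑ s ∈ Finset.univ.filter fun s : Finset V => G.IsClique s,
      (-1 : ℤ) ^ s.card * (if s.card ≤ n then (mcount G (n - s.card) : ℤ) else 0) = 0 := by
  calc
    _ = ∑ s ∈ Finset.univ.filter fun s : Finset V => G.IsClique s, ∑ q ∈ ofLength G n,
          if ∀ x ∈ s, of G x ∣ q then (-1 : ℤ) ^ s.card else 0 := by
      refine Finset.sum_congr rfl fun s hs => ?_
      have h := card_filter_forall_dvd (Finset.mem_filter.1 hs).2 n
      rw [← Finset.sum_filter, Finset.sum_const, h, nsmul_eq_mul, mul_comm]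
      push_cast
      rfl
    _ = ∑ q ∈ ofLength G n, ∑ s ∈ (Finset.univ.filter fun x => of G x ∣ q).powerset,
          (-1 : ℤ) ^ s.card := by
      rw [Finset.sum_comm]
      refine Finset.sum_congr rfl fun q _ => ?_
      rw [← Finset.sum_filter]
      refine Finset.sum_congr ?_ fun _ _ => rfl
      ext s
      simp only [Finset.mem_filter, Finset.mem_univ, true_and, Finset.mem_powerset,
        Finset.subset_iff, and_iff_right_iff_imp]
      exact fun h x hx y hy hne => adj_of_dvd hne (h y hy) (h x hx)
    _ = 0 := by
      refine Finset.sum_eq_zero fun q hq => ?_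
      rw [Finset.sum_powerset_neg_one_pow_card, if_neg]
      obtain ⟨x, hx⟩ := exists_of_dvd (q := q) (by rwa [mem_ofLength.1 hq])
      exact Finset.ne_empty_of_mem (Finset.mem_filter.2 ⟨Finset.mem_univ x, hx⟩)

end TraceMonoid

open scoped Classical in
theorem cliqueCount_eq_card {V : Type*} [Fintype V] (G : SimpleGraph V) (k : ℕ) :
    cliqueCount G k = ((Finset.univ.filter fun s : Finset V => G.IsClique s).filter
      fun s => s.card = k).card := by
  rw [cliqueCount, Nat.card_eq_fintype_card, Fintype.card_subtype, Finset.filter_filter]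
  simp only [SimpleGraph.isNClique_iff]

/-- The numbers `m_n` satisfy the recurrence
`m_n = c_1 m_{n-1} - c_2 m_{n-2} + … + (-1)^{t₀+1} c_{t₀} m_{n-t₀}` for `n ≥ 1`,
where `m_j = 0` for `j < 0` (encoded by the `if k ≤ n` guard). -/
theorem stmt_1 {V : Type*} [Fintype V] [Nonempty V] (G : SimpleGraph V)
    (n : ℕ) (hn : 1 ≤ n) :
    (mcount G n : ℤ) =
      ∑ k ∈ Finset.Icc 1 (cliqueNum G),
        (-1 : ℤ) ^ (k + 1) * (cliqueCount G k : ℤ) *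
          (if k ≤ n then (mcount G (n - k) : ℤ) else 0) := by
  classical
  have hz := TraceMonoid.sum_isClique_eq_zero (G := G) (n := n) (by omega)
  rw [← Finset.sum_fiberwise_of_maps_to (t := Finset.range (cliqueNum G + 1))
    (g := Finset.card)] at hz
  · have hk : ∀ k ∈ Finset.range (cliqueNum G + 1),
        (∑ s ∈ Finset.univ.filter (fun s : Finset V => G.IsClique s) with s.card = k,
          (-1 : ℤ) ^ s.card * (if s.card ≤ n then (mcount G (n - s.card) : ℤ) else 0)) =
        (-1 : ℤ) ^ k * (cliqueCount G k : ℤ) *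
          (if k ≤ n then (mcount G (n - k) : ℤ) else 0) := fun k _ => by
      rw [cliqueCount_eq_card, Finset.sum_congr rfl (g := fun _ =>
        (-1 : ℤ) ^ k * (if k ≤ n then (mcount G (n - k) : ℤ) else 0))
        (fun s hs => by rw [(Finset.mem_filter.1 hs).2]), Finset.sum_const, nsmul_eq_mul]
      ring
    have h0 : cliqueCount G 0 = 1 := by simp [cliqueCount]
    rw [Finset.sum_congr rfl hk, Finset.range_eq_Ico,
      Finset.sum_eq_sum_Ico_succ_bot (Nat.succ_pos _), h0] at hz
    simp only [pow_zero, Nat.cast_one, one_mul, Nat.zero_le, if_true, Nat.sub_zero,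
      zero_add] at hz
    rw [eq_neg_of_add_eq_zero_left hz, ← Finset.sum_neg_distrib]
    refine Finset.sum_congr rfl fun k _ => ?_
    ring
  · intro s hs
    exact Finset.mem_range_succ_iff.2
      (SimpleGraph.IsClique.card_le_cliqueNum (tc := (Finset.mem_filter.1 hs).2))
end
end

section
/- Let G be a finite simple graph. (a) For every induced subgraph H of G with at least one vertex, β(H) ≤ β(G). (b) For every spanning subgraph F of G (a graph on the same vertex set whose edge set is contained in that of G), β(G) ≤ β(F). -/
noncomputable section

/-- The PC-polynomial `PC(G,x) = ∑_{k=0}^{ω(G)} (-1)^k c_k(G) x^{ω(G)-k}`. -/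
def PCpoly {V : Type*} [Fintype V] (G : SimpleGraph V) : Polynomial ℝ :=
  ∑ k ∈ Finset.range (cliqueNum G + 1),
    Polynomial.C ((-1 : ℝ) ^ k * (cliqueCount G k : ℝ)) * Polynomial.X ^ (cliqueNum G - k)

/-- `β(G)`, the largest real root of the PC-polynomial of `G`. -/
def beta {V : Type*} [Fintype V] (G : SimpleGraph V) : ℝ :=
  sSup {x : ℝ | (PCpoly G).eval x = 0}

open Classical in
/-- The signed clique polynomial `∑_K (-t)^|K|` of `G`, over the cliques `K ⊆ S`. -/
def cliqueEval {V : Type*} (G : SimpleGraph V) (S : Finset V) (t : ℝ) : ℝ :=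
  ∑ K ∈ S.powerset, if G.IsClique (K : Set V) then (-t) ^ K.card else 0

/-- `cliqueEval G S` is positive on `[0, t]`. -/
def CliquePos {V : Type*} (G : SimpleGraph V) (S : Finset V) (t : ℝ) : Prop :=
  ∀ s ∈ Set.Icc 0 t, 0 < cliqueEval G S s

lemma exists_first_zero {f : ℝ → ℝ} (hf : Continuous f) (h0 : 0 < f 0) {t : ℝ}
    (h : ¬ ∀ s ∈ Set.Icc 0 t, 0 < f s) :
    ∃ r ∈ Set.Ioc 0 t, f r = 0 ∧ ∀ s ∈ Set.Ico 0 r, 0 < f s := by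
  push Not at h
  obtain ⟨s, hs, hfs⟩ := h
  have hzero : ∀ b, 0 ≤ b → f b ≤ 0 → ∃ r ∈ Set.Icc 0 b, f r = 0 := fun b hb hfb =>
    intermediate_value_Icc' hb hf.continuousOn ⟨hfb, h0.le⟩
  have hcompact : IsCompact (Set.Icc 0 t ∩ f ⁻¹' {0}) :=
    isCompact_Icc.inter_right (isClosed_singleton.preimage hf)
  obtain ⟨r₀, hr₀, hfr₀⟩ := hzero s hs.1 hfs
  obtain ⟨r, ⟨hr, hfr⟩, hmin⟩ := hcompact.exists_isLeast ⟨r₀, ⟨hr₀.1, hr₀.2.trans hs.2⟩, hfr₀⟩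
  have hfr : f r = 0 := hfr
  refine ⟨r, ⟨lt_of_le_of_ne hr.1 ?_, hr.2⟩, hfr, fun u hu => ?_⟩
  · rintro rfl
    exact h0.ne' hfr
  · by_contra hneg
    obtain ⟨w, hw, hfw⟩ := hzero u hu.1 (not_lt.1 hneg)
    have := hmin ⟨⟨hw.1, hw.2.trans (hu.2.le.trans hr.2)⟩, hfw⟩
    linarith [hw.2, hu.2]

section cliqueEval

variable {V : Type*} (G : SimpleGraph V)

lemma continuous_cliqueEval (S : Finset V) : Continuous (cliqueEval G S) := by
  unfold cliqueEval
  refine continuous_finsetSum _ fun K _ => ?_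
  split_ifs <;> fun_prop

lemma cliqueEval_empty (t : ℝ) : cliqueEval G ∅ t = 1 := by
  simp [cliqueEval]

lemma cliqueEval_zero (S : Finset V) : cliqueEval G S 0 = 1 := by
  classical
  unfold cliqueEval
  rw [Finset.sum_eq_single ∅]
  · simp
  · intro K _ hK
    simp [hK]
  · simp

lemma cliqueEval_neg_one_pos (S : Finset V) : 0 < cliqueEval G S (-1) := by
  classical
  unfold cliqueEval
  refine Finset.sum_pos' (fun K _ => ?_) ⟨∅, by simp, by simp⟩
  split_ifs <;> simp

variable {G} in
lemma cliqueEval_congr {H : SimpleGraph V} {S : Finset V}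
    (h : ∀ a ∈ S, ∀ b ∈ S, (G.Adj a b ↔ H.Adj a b)) (t : ℝ) :
    cliqueEval G S t = cliqueEval H S t := by
  classical
  unfold cliqueEval
  refine Finset.sum_congr rfl fun K hK => ?_
  rw [Finset.mem_powerset] at hK
  have : G.IsClique (K : Set V) ↔ H.IsClique (K : Set V) :=
    ⟨fun hc a ha b hb hab => (h a (hK ha) b (hK hb)).1 (hc ha hb hab),
      fun hc a ha b hb hab => (h a (hK ha) b (hK hb)).2 (hc ha hb hab)⟩
  simp only [this]

lemma cliqueEval_insert [DecidableEq V] {v : V} [DecidablePred (G.Adj v)] {S : Finset V}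
    (hv : v ∉ S) (t : ℝ) :
    cliqueEval G (insert v S) t = cliqueEval G S t - t * cliqueEval G (S.filter (G.Adj v)) t := by
  classical
  unfold cliqueEval
  rw [Finset.sum_powerset_insert hv, sub_eq_add_neg, ← neg_mul, Finset.mul_sum]
  congr 1
  have hsub : (S.filter (G.Adj v)).powerset ⊆ S.powerset :=
    Finset.powerset_mono.2 (Finset.filter_subset _ _)
  refine (Finset.sum_subset_zero_on_sdiff hsub ?_ ?_).symm
  · intro K hK
    simp only [Finset.mem_sdiff, Finset.mem_powerset] at hK
    rw [if_neg]
    rw [Finset.coe_insert, SimpleGraph.isClique_insert]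
    rintro ⟨-, h⟩
    refine hK.2 fun w hw => Finset.mem_filter.2 ⟨hK.1 hw, h w hw ?_⟩
    rintro rfl
    exact hv (hK.1 hw)
  · intro K hK
    rw [Finset.mem_powerset] at hK
    have hvK : v ∉ K := fun h => hv (Finset.mem_filter.1 (hK h)).1
    have : G.IsClique ((insert v K : Finset V) : Set V) ↔ G.IsClique (K : Set V) := by
      rw [Finset.coe_insert, SimpleGraph.isClique_insert]
      exact ⟨And.left, fun h => ⟨h, fun w hw _ => (Finset.mem_filter.1 (hK hw)).2⟩⟩
    simp only [this, Finset.card_insert_of_notMem hvK, pow_succ']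
    split_ifs <;> simp

variable {G}

/-- Positivity of the signed clique polynomial on `[0, t]` passes to induced subgraphs. -/
lemma CliquePos.subset {S T : Finset V} (hTS : T ⊆ S) {t : ℝ} (h : CliquePos G S t) :
    CliquePos G T t := by
  classical
  induction S using Finset.strongInduction generalizing T t with
  | H S ih =>
    rcases hTS.eq_or_ssubset with rfl | hss
    · exact h
    obtain ⟨v, hvS, hvT⟩ := Finset.exists_of_ssubset hss
    have ih' := fun {U : Finset V} => ih (S.erase v) (Finset.erase_ssubset hvS) (T := U)
    refine ih' (Finset.subset_erase.2 ⟨hTS, hvT⟩) ?_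
    by_contra hneg
    obtain ⟨r, hr, hr0, hpos⟩ := exists_first_zero (continuous_cliqueEval G (S.erase v))
      (by rw [cliqueEval_zero]; exact one_pos) hneg
    have hN : 0 ≤ cliqueEval G ((S.erase v).filter (G.Adj v)) r := by
      have hIco : ∀ s ∈ Set.Ico 0 r, 0 ≤ cliqueEval G ((S.erase v).filter (G.Adj v)) s :=
        fun s hs => (ih' (Finset.filter_subset _ _)
          (fun u hu => hpos u ⟨hu.1, hu.2.trans_lt hs.2⟩) s ⟨hs.1, le_rfl⟩).le
      have hcl : closure (Set.Ico 0 r) ⊆ {s | 0 ≤ cliqueEval G ((S.erase v).filter (G.Adj v)) s} :=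
        closure_minimal hIco (isClosed_le continuous_const (continuous_cliqueEval G _))
      rw [closure_Ico hr.1.ne] at hcl
      exact hcl ⟨hr.1.le, le_rfl⟩
    have := h r ⟨hr.1.le, hr.2⟩
    rw [← Finset.insert_erase hvS, cliqueEval_insert G (Finset.notMem_erase v S), hr0] at this
    linarith [mul_nonneg hr.1.le hN]

open Classical in
lemma cliqueEval_sup_edge {u v : V} (huv : u ≠ v) (hF : ¬ G.Adj u v) {S : Finset V}
    (hu : u ∈ S) (hv : v ∈ S) (t : ℝ) :
    cliqueEval (G ⊔ SimpleGraph.edge u v) S t =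
      cliqueEval G S t + t ^ 2 * cliqueEval G ((S.filter (G.Adj u)).filter (G.Adj v)) t := by
  have hadj : ∀ a b, a ≠ u → b ≠ u → ((G ⊔ SimpleGraph.edge u v).Adj a b ↔ G.Adj a b) := by
    intro a b ha hb
    simp [SimpleGraph.edge_adj, ha, hb]
  have hcongr : ∀ T : Finset V, u ∉ T →
      cliqueEval (G ⊔ SimpleGraph.edge u v) T t = cliqueEval G T t := fun T hT =>
    cliqueEval_congr (fun a ha b hb => hadj a b (ne_of_mem_of_not_mem ha hT)
      (ne_of_mem_of_not_mem hb hT)) t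
  have huS := Finset.notMem_erase u S
  have hnbr : (S.erase u).filter ((G ⊔ SimpleGraph.edge u v).Adj u) =
      insert v ((S.erase u).filter (G.Adj u)) := by
    ext w
    simp only [Finset.mem_filter, Finset.mem_erase, Finset.mem_insert, SimpleGraph.sup_adj,
      SimpleGraph.edge_adj]
    grind
  have hnbr' : ((S.erase u).filter (G.Adj u)).filter ((G ⊔ SimpleGraph.edge u v).Adj v) =
      (S.filter (G.Adj u)).filter (G.Adj v) := by
    ext w
    simp only [Finset.mem_filter, Finset.mem_erase, SimpleGraph.sup_adj, SimpleGraph.edge_adj]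
    have := G.loopless.irrefl u
    grind
  have h1 := cliqueEval_insert (G ⊔ SimpleGraph.edge u v) huS t
  have h2 := cliqueEval_insert G huS t
  rw [hnbr, cliqueEval_insert _ (v := v) (by simp [hF]), hnbr', hcongr (S.erase u) huS,
    hcongr ((S.erase u).filter (G.Adj u)) (by simp),
    hcongr ((S.filter (G.Adj u)).filter (G.Adj v)) (by simp), Finset.insert_erase hu] at h1
  rw [Finset.insert_erase hu] at h2
  rw [h1, h2]
  ring

/-- Positivity of the signed clique polynomial on `[0, t]` is preserved by adding edges. -/
lemma CliquePos.mono_graph [Fintype V] {F : SimpleGraph V} (hFG : F ≤ G) {t : ℝ}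
    (h : CliquePos F Finset.univ t) : CliquePos G Finset.univ t := by
  classical
  induction F using WellFoundedGT.induction with
  | ind F ih =>
    by_cases hGF : G ≤ F
    · rwa [le_antisymm hGF hFG]
    have : ∃ u v, G.Adj u v ∧ ¬ F.Adj u v := by
      by_contra! hcon
      exact hGF fun u v => hcon u v
    obtain ⟨u, v, hG, hF⟩ := this
    refine ih (F ⊔ SimpleGraph.edge u v) (F.lt_sup_edge _ _ hG.ne hF)
      (sup_le hFG ((SimpleGraph.edge_le_iff G).2 (Or.inr hG))) fun s hs => ?_
    rw [cliqueEval_sup_edge hG.ne hF (Finset.mem_univ _) (Finset.mem_univ _)]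
    exact add_pos_of_pos_of_nonneg (h s hs)
      (mul_nonneg (sq_nonneg s) (h.subset (Finset.subset_univ _) s hs).le)

lemma cliqueEval_induce (S : Finset V) (t : ℝ) :
    cliqueEval (G.induce (S : Set V)) Finset.univ t = cliqueEval G S t := by
  classical
  unfold cliqueEval
  rw [Finset.powerset_univ]
  refine Finset.sum_bij (fun K _ => K.map (Function.Embedding.subtype _)) ?_ ?_ ?_ ?_
  · intro K _
    rw [Finset.mem_powerset]
    intro x hx
    obtain ⟨y, -, rfl⟩ := Finset.mem_map.1 hx
    exact y.2
  · intro K _ L _ h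
    exact Finset.map_injective _ h
  · intro K hK
    rw [Finset.mem_powerset] at hK
    refine ⟨K.subtype (· ∈ (S : Set V)), Finset.mem_univ _, ?_⟩
    exact Finset.subtype_map_of_mem fun x hx => hK hx
  · intro K _
    have : (G.induce (S : Set V)).IsClique (K : Set (S : Set V)) ↔
        G.IsClique ((K.map (Function.Embedding.subtype _) : Finset V) : Set V) := by
      rw [Finset.coe_map]
      constructor
      · rintro h _ ⟨a, ha, rfl⟩ _ ⟨b, hb, rfl⟩ hab
        exact h ha hb fun hab' => hab (by rw [hab'])
      · intro h a ha b hb hab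
        exact h ⟨a, ha, rfl⟩ ⟨b, hb, rfl⟩ fun hab' => hab (Subtype.ext hab')
    simp only [this, Finset.card_map]

/-- On a nonempty vertex set the signed clique polynomial has a root in `(0, 1]`. -/
lemma not_cliquePos_one {S : Finset V} (hS : S.Nonempty) : ¬ CliquePos G S 1 := by
  classical
  obtain ⟨v, hv⟩ := hS
  intro h
  have := h.subset (Finset.singleton_subset_iff.2 hv) 1 ⟨zero_le_one, le_rfl⟩
  rw [← insert_empty_eq, cliqueEval_insert G (Finset.notMem_empty v)] at this
  simp [cliqueEval_empty] at this

end cliqueEval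

section beta

variable {V : Type*} [Fintype V] (G : SimpleGraph V)

lemma card_le_cliqueNum {K : Finset V} (hK : G.IsClique (K : Set V)) :
    K.card ≤ cliqueNum G := by
  refine le_csSup ⟨Fintype.card V, ?_⟩ ⟨K, hK, rfl⟩
  rintro _ ⟨s, hs⟩
  rw [← hs.card_eq]
  exact Finset.card_le_univ s

lemma cliqueEval_univ (t : ℝ) :
    cliqueEval G Finset.univ t =
      ∑ k ∈ Finset.range (cliqueNum G + 1), (cliqueCount G k : ℝ) * (-t) ^ k := by
  classical
  unfold cliqueEval
  rw [Finset.powerset_univ, ← Finset.sum_filter,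
    ← Finset.sum_fiberwise_of_maps_to (t := Finset.range (cliqueNum G + 1))
      (g := Finset.card)]
  · refine Finset.sum_congr rfl fun k _ => ?_
    rw [Finset.sum_congr rfl (g := fun _ => (-t) ^ k)
      fun K hK => by rw [(Finset.mem_filter.1 hK).2]]
    rw [Finset.sum_const, nsmul_eq_mul, Finset.filter_filter]
    congr 2
    rw [cliqueCount, Nat.card_eq_fintype_card, Fintype.card_subtype]
    simp only [SimpleGraph.isNClique_iff]
  · intro K hK
    rw [Finset.mem_range, Nat.lt_succ_iff]
    exact card_le_cliqueNum G (Finset.mem_filter.1 hK).2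

lemma eval_PCpoly {x : ℝ} (hx : x ≠ 0) :
    (PCpoly G).eval x = x ^ cliqueNum G * cliqueEval G Finset.univ x⁻¹ := by
  rw [cliqueEval_univ, PCpoly, Polynomial.eval_finsetSum, Finset.mul_sum]
  refine Finset.sum_congr rfl fun k hk => ?_
  have hk : k ≤ cliqueNum G := Nat.lt_succ_iff.1 (Finset.mem_range.1 hk)
  simp only [Polynomial.eval_mul, Polynomial.eval_C, Polynomial.eval_pow, Polynomial.eval_X]
  rw [pow_sub₀ x hx hk, neg_pow x⁻¹, inv_pow]
  ring

lemma eval_PCpoly_eq_zero_iff {x : ℝ} (hx : x ≠ 0) :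
    (PCpoly G).eval x = 0 ↔ cliqueEval G Finset.univ x⁻¹ = 0 := by
  rw [eval_PCpoly G hx, mul_eq_zero, or_iff_right (pow_ne_zero _ hx)]

lemma PCpoly_ne_zero : PCpoly G ≠ 0 := by
  intro h
  have h1 : (PCpoly G).eval (-1) = 0 := by rw [h, Polynomial.eval_zero]
  rw [eval_PCpoly_eq_zero_iff G (by norm_num), inv_neg_one] at h1
  exact (cliqueEval_neg_one_pos G Finset.univ).ne' h1

lemma bddAbove_roots_PCpoly : BddAbove {x : ℝ | (PCpoly G).eval x = 0} :=
  (Polynomial.finite_setOfPred_isRoot (PCpoly_ne_zero G)).bddAbove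

variable {G}

lemma inv_le_beta {t : ℝ} (h : ¬ CliquePos G Finset.univ t) : t⁻¹ ≤ beta G := by
  obtain ⟨r, hr, hr0, -⟩ := exists_first_zero (continuous_cliqueEval G Finset.univ)
    (by rw [cliqueEval_zero]; exact one_pos) h
  refine (inv_anti₀ hr.1 hr.2).trans (le_csSup (bddAbove_roots_PCpoly G) ?_)
  rw [Set.mem_ofPred_eq, eval_PCpoly_eq_zero_iff G (inv_ne_zero hr.1.ne'), inv_inv, hr0]

lemma beta_le_beta [Nonempty V] {W : Type*} [Fintype W] {H : SimpleGraph W}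
    (h : ∀ t, CliquePos G Finset.univ t → CliquePos H Finset.univ t) : beta H ≤ beta G := by
  have hG : 0 ≤ beta G :=
    (inv_nonneg.2 zero_le_one).trans (inv_le_beta (not_cliquePos_one Finset.univ_nonempty))
  refine Real.sSup_le (fun x hx => ?_) hG
  rcases le_or_gt x 0 with hx0 | hx0
  · exact hx0.trans hG
  rw [Set.mem_ofPred_eq, eval_PCpoly_eq_zero_iff H hx0.ne'] at hx
  rw [← inv_inv x]
  exact inv_le_beta fun hpos => (h _ hpos x⁻¹ ⟨(inv_pos.2 hx0).le, le_rfl⟩).ne' hx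

end beta

/-- (a) For every induced subgraph `H` of `G` on a nonempty vertex set, `β(H) ≤ β(G)`.
(b) For every spanning subgraph `F` of `G`, `β(G) ≤ β(F)`. -/
theorem stmt_3 {V : Type*} [Fintype V] (G : SimpleGraph V) :
    (∀ s : Finset V, s.Nonempty → beta (G.induce (s : Set V)) ≤ beta G) ∧
    (∀ F : SimpleGraph V, F ≤ G → beta G ≤ beta F) := by
  refine ⟨fun s hs => ?_, fun F hF => ?_⟩
  · have : Nonempty V := ⟨hs.choose⟩
    refine beta_le_beta fun t ht u hu => ?_
    rw [cliqueEval_induce]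
    exact ht.subset (Finset.subset_univ s) u hu
  · rcases isEmpty_or_nonempty V with hV | hV
    · rw [Subsingleton.elim F G]
    · exact beta_le_beta fun t ht => ht.mono_graph hF
end
end

section
/- Let G be a finite simple graph with n ≥ 1 vertices and clique number w = ω(G). Then for every real x > 0, C(G,x) ≤ (1 + nx/w)^w, and equality holds for every x > 0 if and only if G is a complete multipartite graph all of whose parts have the same size. -/
noncomputable section

/-- The clique polynomial `C(G,x) = ∑_{k=0}^{ω(G)} c_k(G) x^k`, evaluated at `x`. -/
def cliquePolyEval {V : Type*} [Fintype V] (G : SimpleGraph V) (x : ℝ) : ℝ :=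
  ∑ k ∈ Finset.range (cliqueNum G + 1), (cliqueCount G k : ℝ) * x ^ k

/-- `G` is a complete multipartite graph all of whose parts have the same size. -/
def IsCompleteMultipartiteEqualParts {V : Type*} [Fintype V] (G : SimpleGraph V) : Prop :=
  ∃ (r : ℕ) (f : V → Fin r),
    (∀ i j : Fin r, (Finset.univ.filter (fun v => f v = i)).card
        = (Finset.univ.filter (fun v => f v = j)).card) ∧
    (∀ u v : V, G.Adj u v ↔ f u ≠ f v)

/-- The multivariate clique polynomial: the sum over all cliques of the products of the weights. -/
def cliqueWeight {V : Type*} [Fintype V] (G : SimpleGraph V) (y : V → ℝ) : ℝ :=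
  open Classical in
  ∑ s ∈ (Finset.univ : Finset V).powerset, if G.IsClique s then ∏ v ∈ s, y v else 0

/-- The partial derivative of `cliqueWeight G` at `v`: the weight of the cliques in the
neighbourhood of `v`. -/
def linkWeight {V : Type*} [Fintype V] (G : SimpleGraph V) (v : V) (y : V → ℝ) : ℝ :=
  open Classical in cliqueWeight G fun u => if G.Adj v u then y u else 0

open Classical in
theorem cliqueWeight_eq_update_zero_add {V : Type*} [Fintype V] (G : SimpleGraph V)
    (y : V → ℝ) (v : V) :
    cliqueWeight G y = cliqueWeight G (Function.update y v 0) + y v * linkWeight G v y := by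
  have hv : v ∉ Finset.univ.erase v := by simp
  have hsub : ∀ s ∈ (Finset.univ.erase v).powerset, v ∉ s := fun s hs h =>
    hv (Finset.mem_powerset.1 hs h)
  have key (z : V → ℝ) : cliqueWeight G z =
      (∑ s ∈ (Finset.univ.erase v).powerset, if G.IsClique s then ∏ u ∈ s, z u else 0) +
      ∑ s ∈ (Finset.univ.erase v).powerset,
        if G.IsClique (insert v s : Finset V) then z v * ∏ u ∈ s, z u else 0 := by
    conv_lhs => rw [cliqueWeight, ← Finset.insert_erase (Finset.mem_univ v),
      Finset.sum_powerset_insert hv]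
    congr 1
    refine Finset.sum_congr rfl fun s hs => ?_
    rw [Finset.prod_insert (hsub s hs)]
  rw [linkWeight, key y, key (Function.update y v 0), key (fun u => if G.Adj v u then y u else 0)]
  simp only [Function.update_self, zero_mul, ite_self, Finset.sum_const_zero, add_zero,
    SimpleGraph.irrefl, if_false]
  rw [Finset.mul_sum]
  congr 1
  · refine Finset.sum_congr rfl fun s hs => ?_
    rw [Finset.prod_update_of_notMem (hsub s hs)]
  · refine Finset.sum_congr rfl fun s hs => ?_
    have hvs := hsub s hs
    have hi : G.IsClique (insert v s : Finset V) ↔ G.IsClique s ∧ ∀ b ∈ s, G.Adj v b := by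
      rw [Finset.coe_insert, SimpleGraph.isClique_insert_of_notMem (by simpa using hvs)]
      rfl
    by_cases hc : G.IsClique s
    · by_cases ha : ∀ b ∈ s, G.Adj v b
      · rw [if_pos (hi.2 ⟨hc, ha⟩), if_pos hc]
        congr 1
        exact Finset.prod_congr rfl fun u hu => by rw [if_pos (ha u hu)]
      · rw [if_neg fun h => ha (hi.1 h).2, if_pos hc]
        push Not at ha
        obtain ⟨b, hb, hvb⟩ := ha
        rw [Finset.prod_eq_zero hb (by simp [hvb]), mul_zero]
    · rw [if_neg fun h => hc (hi.1 h).1, if_neg hc, mul_zero]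

theorem linkWeight_update_of_not_adj {V : Type*} [Fintype V] [DecidableEq V]
    (G : SimpleGraph V) {u v : V} (h : ¬G.Adj u v) (y : V → ℝ) (a : ℝ) :
    linkWeight G u (Function.update y v a) = linkWeight G u y := by
  unfold linkWeight
  congr 1
  funext t
  by_cases ht : t = v
  · subst ht; simp [h]
  · simp [Function.update_of_ne ht]

theorem cliqueWeight_update {V : Type*} [Fintype V] [DecidableEq V] (G : SimpleGraph V)
    (y : V → ℝ) (v : V) (a : ℝ) :
    cliqueWeight G (Function.update y v a) = cliqueWeight G y + (a - y v) * linkWeight G v y := by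
  have h1 := cliqueWeight_eq_update_zero_add G y v
  have h2 := cliqueWeight_eq_update_zero_add G (Function.update y v a) v
  rw [linkWeight_update_of_not_adj G (G.irrefl), Function.update_self] at h2
  have e : (fun i j => Classical.propDecidable (i = j)) = (‹DecidableEq V› : DecidableEq V) :=
    Subsingleton.elim _ _
  rw [e] at h1 h2
  rw [Function.update_idem] at h2
  rw [h1, h2]
  ring

theorem one_le_cliqueWeight {V : Type*} [Fintype V] (G : SimpleGraph V) {y : V → ℝ}
    (hy : ∀ v, 0 ≤ y v) : 1 ≤ cliqueWeight G y := by
  classical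
  unfold cliqueWeight
  refine le_trans ?_ (Finset.single_le_sum (fun s _ => ?_) (Finset.empty_mem_powerset _))
  · simp
  · split_ifs
    · exact Finset.prod_nonneg fun v _ => hy v
    · rfl

/-- Moving the weight of `v` onto a non-adjacent vertex `u`. -/
theorem cliqueWeight_shift {V : Type*} [Fintype V] [DecidableEq V] (G : SimpleGraph V)
    {u v : V} (huv : u ≠ v) (h : ¬G.Adj u v) (y : V → ℝ) :
    cliqueWeight G (Function.update (Function.update y v 0) u (y u + y v)) =
      cliqueWeight G y + y v * (linkWeight G u y - linkWeight G v y) := by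
  rw [cliqueWeight_update, cliqueWeight_update, linkWeight_update_of_not_adj G h,
    Function.update_of_ne huv]
  ring

theorem sum_update_eq_add_sub {V : Type*} [Fintype V] [DecidableEq V] (y : V → ℝ) (v : V) (a : ℝ) :
    ∑ i, Function.update y v a i = ∑ i, y i + (a - y v) := by
  rw [Finset.sum_update_of_mem (Finset.mem_univ v),
    ← Finset.add_sum_erase Finset.univ y (Finset.mem_univ v), Finset.erase_eq]
  ring

theorem prod_one_add_le_pow {ι : Type*} {s : Finset ι} (hs : s.Nonempty) {y : ι → ℝ}
    (hy : ∀ i ∈ s, 0 ≤ y i) :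
    ∏ i ∈ s, (1 + y i) ≤ (1 + (∑ i ∈ s, y i) / s.card) ^ s.card ∧
      (∏ i ∈ s, (1 + y i) = (1 + (∑ i ∈ s, y i) / s.card) ^ s.card →
        ∀ i ∈ s, ∀ j ∈ s, y i = y j) := by
  have hc : 0 < (s.card : ℝ) := by exact_mod_cast hs.card_pos
  have hz : ∀ i ∈ s, 0 ≤ 1 + y i := fun i hi => add_nonneg zero_le_one (hy i hi)
  have hw : ∑ i ∈ s, (s.card : ℝ)⁻¹ = 1 := by
    rw [Finset.sum_const, nsmul_eq_mul, mul_inv_cancel₀ hc.ne']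
  have hsum : ∑ i ∈ s, (s.card : ℝ)⁻¹ * (1 + y i) = 1 + (∑ i ∈ s, y i) / s.card := by
    rw [← Finset.mul_sum, Finset.sum_add_distrib, Finset.sum_const, nsmul_eq_mul]
    field_simp
  have hprod : ∏ i ∈ s, (1 + y i) ^ (s.card : ℝ)⁻¹ = (∏ i ∈ s, (1 + y i)) ^ (s.card : ℝ)⁻¹ :=
    Real.finsetProd_rpow _ _ hz _
  have hP : 0 ≤ ∏ i ∈ s, (1 + y i) := Finset.prod_nonneg hz
  have hS : 0 ≤ 1 + (∑ i ∈ s, y i) / s.card :=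
    add_nonneg zero_le_one (div_nonneg (Finset.sum_nonneg hy) hc.le)
  constructor
  · have := Real.geom_mean_le_arith_mean_weighted s (fun _ => (s.card : ℝ)⁻¹) (fun i => 1 + y i)
      (fun _ _ => (inv_pos.2 hc).le) hw hz
    rw [hsum, hprod] at this
    have h2 := pow_le_pow_left₀ (Real.rpow_nonneg hP _) this s.card
    rwa [Real.rpow_inv_natCast_pow hP hs.card_pos.ne'] at h2
  · intro h i hi j hj
    have := (Real.geom_mean_eq_arith_mean_weighted_iff_of_pos s (fun _ => (s.card : ℝ)⁻¹)
      (fun i => 1 + y i) (fun _ _ => inv_pos.2 hc) hw hz).1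
      (by rw [hsum, hprod, h, Real.pow_rpow_inv_natCast hS hs.card_pos.ne']) i hi j hj
    linarith

theorem cliqueWeight_eq_prod {V : Type*} [Fintype V] (G : SimpleGraph V) {y : V → ℝ}
    (h : G.IsClique {v | y v ≠ 0}) : cliqueWeight G y = ∏ v, (1 + y v) := by
  classical
  rw [Finset.prod_one_add, cliqueWeight]
  refine Finset.sum_congr rfl fun s _ => ?_
  split_ifs with hs
  · rfl
  · by_contra hne
    exact hs (h.subset fun v hv => Finset.prod_ne_zero_iff.1 (Ne.symm hne) v hv)

theorem card_le_cliqueNum_s6 {V : Type*} [Fintype V] {G : SimpleGraph V} {s : Finset V}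
    (hs : G.IsClique s) : s.card ≤ cliqueNum G :=
  SimpleGraph.IsClique.card_le_cliqueNum (tc := hs)

theorem exists_isNClique_cliqueNum {V : Type*} [Fintype V] (G : SimpleGraph V) :
    ∃ s, G.IsNClique (cliqueNum G) s :=
  SimpleGraph.exists_isNClique_cliqueNum

theorem cliqueNum_pos {V : Type*} [Fintype V] [Nonempty V] (G : SimpleGraph V) :
    0 < cliqueNum G := by
  obtain ⟨v⟩ := ‹Nonempty V›
  have := card_le_cliqueNum_s6 (G := G) (s := {v}) (by simp)
  exact this

theorem cliqueWeight_le {V : Type*} [Fintype V] [Nonempty V] (G : SimpleGraph V) (y : V → ℝ)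
    (hy : ∀ v, 0 ≤ y v) :
    cliqueWeight G y ≤ (1 + (∑ v, y v) / cliqueNum G) ^ cliqueNum G := by
  classical
  induction hn : (Finset.univ.filter fun v => y v ≠ 0).card using Nat.strong_induction_on
    generalizing y with
  | _ n ih =>
  by_cases hc : G.IsClique {v | y v ≠ 0}
  · obtain ⟨c, hcc⟩ := exists_isNClique_cliqueNum G
    obtain ⟨t, hst, ht⟩ := Finset.exists_superset_card_eq (n := cliqueNum G)
      (s := Finset.univ.filter fun v => y v ≠ 0) (card_le_cliqueNum_s6 (by simpa using hc))
      (hcc.card_eq ▸ c.card_le_univ)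
    have h0 : ∀ v ∉ t, y v = 0 := fun v hv => by
      by_contra h
      exact hv (hst (by simpa using h))
    have ht0 : t.Nonempty := Finset.card_pos.1 (ht ▸ cliqueNum_pos G)
    rw [cliqueWeight_eq_prod G hc, ← ht,
      ← Finset.sum_subset t.subset_univ fun v _ hv => h0 v hv,
      ← Finset.prod_subset t.subset_univ fun v _ hv => by rw [h0 v hv, add_zero]]
    exact (prod_one_add_le_pow ht0 fun i _ => hy i).1
  · have step : ∀ u v, u ≠ v → ¬G.Adj u v → y u ≠ 0 → y v ≠ 0 →
        linkWeight G v y ≤ linkWeight G u y →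
        cliqueWeight G y ≤ (1 + (∑ v, y v) / cliqueNum G) ^ cliqueNum G := by
      intro u v huv hadj hu hv hle
      have h1 := cliqueWeight_shift G huv hadj y
      have h2 := ih _ (?_) (Function.update (Function.update y v 0) u (y u + y v)) ?_ rfl
      · rw [sum_update_eq_add_sub, sum_update_eq_add_sub, Function.update_of_ne huv] at h2
        have h3 : ∑ i, y i + (0 - y v) + (y u + y v - y u) = ∑ i, y i := by ring
        rw [h3, h1] at h2
        nlinarith [mul_nonneg (hy v) (sub_nonneg.2 hle)]
      · rw [← hn]
        refine Finset.card_lt_card ⟨fun i => ?_, fun h => ?_⟩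
        · by_cases hi : i = u
          · subst hi; simp [hu]
          · by_cases hi' : i = v
            · subst hi'; simp [hv]
            · simp [Function.update_of_ne hi, Function.update_of_ne hi']
        · have := h (show v ∈ _ by simpa using hv)
          simp [Function.update_of_ne huv.symm] at this
      · intro i
        by_cases hi : i = u
        · subst hi; simpa using add_nonneg (hy _) (hy _)
        · by_cases hi' : i = v
          · subst hi'; simp [Function.update_of_ne hi]
          · simpa [Function.update_of_ne hi, Function.update_of_ne hi'] using hy i
    rw [SimpleGraph.isClique_iff, Set.Pairwise] at hc
    push Not at hc
    obtain ⟨u, hu, v, hv, huv, hadj⟩ := hc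
    rcases le_total (linkWeight G v y) (linkWeight G u y) with h | h
    · exact step u v huv hadj hu hv h
    · exact step v u huv.symm (fun h => hadj h.symm) hv hu h

theorem cliqueWeight_const {V : Type*} [Fintype V] (G : SimpleGraph V) (x : ℝ) :
    cliqueWeight G (fun _ => x) = cliquePolyEval G x := by
  classical
  unfold cliqueWeight cliquePolyEval
  rw [← Finset.sum_filter]
  simp only [Finset.prod_const]
  rw [← Finset.sum_fiberwise_of_maps_to (t := Finset.range (cliqueNum G + 1))
    (g := fun s : Finset V => s.card)
    (fun s hs => Finset.mem_range.2 (Nat.lt_succ_of_le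
      (card_le_cliqueNum_s6 (Finset.mem_filter.1 hs).2)))]
  refine Finset.sum_congr rfl fun k _ => ?_
  rw [Finset.sum_congr rfl (g := fun _ => x ^ k)
    (fun s hs => by rw [(Finset.mem_filter.1 hs).2]), Finset.sum_const, nsmul_eq_mul]
  congr 2
  rw [cliqueCount, Nat.card_eq_fintype_card, Fintype.card_subtype]
  congr 1
  ext s
  simp [SimpleGraph.isNClique_iff]

/-- The clique weight of a complete multipartite graph is the product over its parts. -/
theorem cliqueWeight_multipartite {V ι : Type*} [Fintype V] [Fintype ι] [DecidableEq ι]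
    (G : SimpleGraph V) (f : V → ι) (hf : ∀ u v, G.Adj u v ↔ f u ≠ f v) (y : V → ℝ) :
    cliqueWeight G y = ∏ i, (1 + ∑ v ∈ Finset.univ.filter (fun v => f v = i), y v) := by
  classical
  induction hn : (Finset.univ.filter fun v => y v ≠ 0).card using Nat.strong_induction_on
    generalizing y with
  | _ n ih =>
  by_cases h0 : ∀ v, y v = 0
  · rw [cliqueWeight_eq_prod G (by simp [h0])]
    simp [h0]
  · push Not at h0
    obtain ⟨v, hv⟩ := h0
    rw [cliqueWeight_eq_update_zero_add G y v, linkWeight]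
    rw [ih _ (?_) (Function.update y v 0) rfl,
      ih _ (?_) (fun u => if G.Adj v u then y u else 0) rfl]
    · rw [← Finset.mul_prod_erase Finset.univ _ (Finset.mem_univ (f v)),
        ← Finset.mul_prod_erase Finset.univ _ (Finset.mem_univ (f v)),
        ← Finset.mul_prod_erase Finset.univ _ (Finset.mem_univ (f v))]
      have e1 : ∀ i ∈ Finset.univ.erase (f v),
          1 + ∑ u ∈ Finset.univ.filter (fun u => f u = i), Function.update y v 0 u =
          1 + ∑ u ∈ Finset.univ.filter (fun u => f u = i), y u := fun i hi => by
        rw [Finset.sum_update_of_notMem]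
        simpa using (Finset.ne_of_mem_erase hi).symm
      have e2 : ∀ i ∈ Finset.univ.erase (f v),
          1 + ∑ u ∈ Finset.univ.filter (fun u => f u = i), (if G.Adj v u then y u else 0) =
          1 + ∑ u ∈ Finset.univ.filter (fun u => f u = i), y u := fun i hi => by
        congr 1
        refine Finset.sum_congr rfl fun u hu => if_pos ?_
        rw [hf, (Finset.mem_filter.1 hu).2]
        exact (Finset.ne_of_mem_erase hi).symm
      have e3 : ∑ u ∈ Finset.univ.filter (fun u => f u = f v),
          (if G.Adj v u then y u else 0) = 0 :=
        Finset.sum_eq_zero fun u hu => if_neg (by simp [hf, (Finset.mem_filter.1 hu).2])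
      have hmem : v ∈ Finset.univ.filter fun u => f u = f v := by simp
      rw [Finset.prod_congr rfl e1, Finset.prod_congr rfl e2, e3,
        Finset.sum_update_of_mem hmem, Finset.sdiff_singleton_eq_erase,
        ← Finset.add_sum_erase _ y hmem]
      ring
    · rw [← hn]
      refine Finset.card_lt_card ⟨fun i => ?_, fun h => ?_⟩
      · simp only [Finset.mem_filter, Finset.mem_univ, true_and, ne_eq, ite_eq_right_iff]
        tauto
      · have := h (show v ∈ _ by simpa using hv)
        simp at this
    · rw [← hn]
      refine Finset.card_lt_card ⟨fun i => ?_, fun h => ?_⟩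
      · by_cases hi : i = v
        · subst hi; simp
        · simp [Function.update_of_ne hi]
      · have := h (show v ∈ _ by simpa using hv)
        simp at this

theorem cliqueNum_multipartite {V ι : Type*} [Fintype V] [Fintype ι] (G : SimpleGraph V)
    (f : V → ι) (hf : ∀ u v, G.Adj u v ↔ f u ≠ f v) (hsurj : Function.Surjective f) :
    cliqueNum G = Fintype.card ι := by
  classical
  apply le_antisymm
  · obtain ⟨c, hc⟩ := exists_isNClique_cliqueNum G
    rw [← hc.card_eq, ← Finset.card_univ]
    refine Finset.card_le_card_of_injOn f (fun _ _ => Finset.mem_univ _) fun u hu v hv h => ?_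
    by_contra hne
    exact (hf u v).1 (hc.isClique hu hv hne) h
  · obtain ⟨g, hg⟩ := hsurj.hasRightInverse
    rw [← Finset.card_univ, ← Finset.card_image_of_injective _ hg.injective]
    refine card_le_cliqueNum_s6 fun u hu v hv hne => (hf u v).2 fun h => ?_
    simp only [Finset.coe_image, Finset.coe_univ, Set.image_univ, Set.mem_range] at hu hv
    obtain ⟨i, rfl⟩ := hu
    obtain ⟨j, rfl⟩ := hv
    rw [hg, hg] at h
    exact hne (by rw [h])

theorem linkWeight_le_of_cliqueWeight_eq {V : Type*} [Fintype V] [Nonempty V]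
    (G : SimpleGraph V) {y : V → ℝ} (hy : ∀ v, 0 < y v)
    (heq : cliqueWeight G y = (1 + (∑ v, y v) / cliqueNum G) ^ cliqueNum G)
    {u v : V} (h : ¬G.Adj u v) : linkWeight G u y ≤ linkWeight G v y := by
  classical
  rcases eq_or_ne u v with rfl | huv
  · rfl
  have h1 := cliqueWeight_shift G huv h y
  have h2 := cliqueWeight_le G (Function.update (Function.update y v 0) u (y u + y v)) fun i => by
    by_cases hi : i = u
    · subst hi; simpa using (add_pos (hy _) (hy _)).le
    · by_cases hi' : i = v
      · subst hi'; simp [Function.update_of_ne hi]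
      · simpa [Function.update_of_ne hi, Function.update_of_ne hi'] using (hy i).le
  rw [sum_update_eq_add_sub, sum_update_eq_add_sub, Function.update_of_ne huv] at h2
  have h3 : ∑ i, y i + (0 - y v) + (y u + y v - y u) = ∑ i, y i := by ring
  rw [h3, h1, ← heq] at h2
  by_contra! hlt
  nlinarith [mul_pos (hy v) (sub_pos.2 hlt)]

/-- At an interior maximum of the clique weight, non-adjacency is transitive. -/
theorem isCompleteMultipartite_of_cliqueWeight_eq {V : Type*} [Fintype V] [Nonempty V]
    (G : SimpleGraph V) {y : V → ℝ} (hy : ∀ v, 0 < y v)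
    (heq : cliqueWeight G y = (1 + (∑ v, y v) / cliqueNum G) ^ cliqueNum G) :
    G.IsCompleteMultipartite := by
  classical
  refine ⟨fun u v t huv hvt hut => ?_⟩
  have htv : ¬G.Adj t v := fun h => hvt h.symm
  have hne1 : u ≠ v := by rintro rfl; exact hvt hut
  have hne2 : t ≠ v := by rintro rfl; exact huv hut
  have hne3 : t ≠ u := hut.ne'
  have d1 := linkWeight_le_of_cliqueWeight_eq G hy heq (u := v) (v := u) fun h => huv h.symm
  have d2 := linkWeight_le_of_cliqueWeight_eq G hy heq (u := v) (v := t) hvt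
  set y₀ := Function.update y v 0 with hy₀
  set y₁ := Function.update y₀ u (y u + y v / 2) with hy₁
  set y₂ := Function.update y₁ t (y t + y v / 2) with hy₂
  have nn₀ : ∀ i, 0 ≤ y₀ i := fun i => by
    by_cases hi : i = v
    · subst hi; simp [hy₀]
    · simpa [hy₀, Function.update_of_ne hi] using (hy i).le
  have nn₁ : ∀ i, 0 ≤ y₁ i := fun i => by
    by_cases hi : i = u
    · subst hi; simpa [hy₁] using (add_pos (hy i) (half_pos (hy v))).le
    · simpa [hy₁, Function.update_of_ne hi] using nn₀ i
  have nn₂ : ∀ i, 0 ≤ y₂ i := fun i => by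
    by_cases hi : i = t
    · subst hi; simpa [hy₂] using (add_pos (hy i) (half_pos (hy v))).le
    · simpa [hy₂, Function.update_of_ne hi] using nn₁ i
  have eu : y₀ u = y u := Function.update_of_ne hne1 _ _
  have et : y₁ t = y t := by rw [hy₁, Function.update_of_ne hne3, hy₀, Function.update_of_ne hne2]
  have f0 : cliqueWeight G y₀ = cliqueWeight G y + (0 - y v) * linkWeight G v y :=
    cliqueWeight_update G y v 0
  have f1 : cliqueWeight G y₁ = cliqueWeight G y₀ + (y u + y v / 2 - y u) * linkWeight G u y := by
    rw [hy₁, cliqueWeight_update, eu, hy₀, linkWeight_update_of_not_adj G huv]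
  have f2 : cliqueWeight G y₂ = cliqueWeight G y₁ + (y t + y v / 2 - y t) * linkWeight G t y₁ := by
    rw [hy₂, cliqueWeight_update, et]
  have f3 : linkWeight G t y + y v / 2 ≤ linkWeight G t y₁ := by
    have e : (fun i => if G.Adj t i then y₁ i else 0) =
        Function.update (fun i => if G.Adj t i then y₀ i else 0) u (y u + y v / 2) := by
      funext i
      by_cases hi : i = u
      · subst hi; simp [hy₁, hut.symm]
      · simp [hy₁, Function.update_of_ne hi]
    have e2 : linkWeight G t y₁ = linkWeight G t y₀ + (y u + y v / 2 - y u) *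
        linkWeight G u (fun i => if G.Adj t i then y₀ i else 0) := by
      have := cliqueWeight_update G (fun i => if G.Adj t i then y₀ i else 0) u (y u + y v / 2)
      rw [← e, if_pos hut.symm, eu] at this
      exact this
    have e3 : 1 ≤ linkWeight G u (fun i => if G.Adj t i then y₀ i else 0) :=
      one_le_cliqueWeight G fun i => by
        dsimp only
        split_ifs
        exacts [nn₀ i, le_rfl, le_rfl]
    rw [e2, hy₀, linkWeight_update_of_not_adj G htv]
    nlinarith [hy v]
  have hle := cliqueWeight_le G y₂ nn₂
  have hs : ∑ i, y₂ i = ∑ i, y i := by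
    rw [hy₂, sum_update_eq_add_sub, et, hy₁, sum_update_eq_add_sub, eu, hy₀,
      sum_update_eq_add_sub]
    ring
  rw [hs, ← heq, f2, f1, f0] at hle
  nlinarith [hy v, mul_pos (hy v) (hy v), mul_le_mul_of_nonneg_left d1 (hy v).le,
    mul_le_mul_of_nonneg_left d2 (hy v).le, mul_le_mul_of_nonneg_left f3 (hy v).le]

/-- For all `x > 0`, `C(G,x) ≤ (1 + nx/w)^w`, with equality (for every `x > 0`)
iff `G` is a complete multipartite graph with equal parts. -/
theorem stmt_6 {V : Type*} [Fintype V] [Nonempty V] (G : SimpleGraph V) :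
    (∀ x : ℝ, 0 < x →
      cliquePolyEval G x
        ≤ (1 + (Fintype.card V : ℝ) * x / (cliqueNum G : ℝ)) ^ (cliqueNum G)) ∧
    ((∀ x : ℝ, 0 < x →
      cliquePolyEval G x
        = (1 + (Fintype.card V : ℝ) * x / (cliqueNum G : ℝ)) ^ (cliqueNum G)) ↔
      IsCompleteMultipartiteEqualParts G) := by
  classical
  have hpoly (x : ℝ) : ∑ _v : V, x = (Fintype.card V : ℝ) * x := by simp
  refine ⟨fun x hx => ?_, fun h => ?_, ?_⟩
  · rw [← cliqueWeight_const, ← hpoly]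
    exact cliqueWeight_le G _ fun _ => hx.le
  · have h1 := h 1 one_pos
    rw [← cliqueWeight_const, ← hpoly] at h1
    have hm := isCompleteMultipartite_of_cliqueWeight_eq G (fun _ => one_pos) h1
    let e := Fintype.equivFin (Quotient hm.setoid)
    let f : V → Fin (Fintype.card (Quotient hm.setoid)) := fun v => e (Quotient.mk hm.setoid v)
    have hf : ∀ u v, G.Adj u v ↔ f u ≠ f v := fun u v => by
      have : f u = f v ↔ ¬G.Adj u v := by
        rw [e.injective.eq_iff, Quotient.eq]
        rfl
      rw [Ne, this, not_not]
    have hsurj : Function.Surjective f := e.surjective.comp Quotient.mk_surjective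
    have hpos : 0 < Fintype.card (Quotient hm.setoid) :=
      Fin.pos (f (Classical.arbitrary V))
    have hne : (Finset.univ : Finset (Fin (Fintype.card (Quotient hm.setoid)))).Nonempty :=
      ⟨⟨0, hpos⟩, Finset.mem_univ _⟩
    refine ⟨_, f, fun i j => ?_, hf⟩
    rw [cliqueNum_multipartite G f hf hsurj, cliqueWeight_multipartite G f hf,
      ← Finset.sum_fiberwise Finset.univ f] at h1
    have := (prod_one_add_le_pow hne fun i _ =>
      Finset.sum_nonneg fun _ _ => zero_le_one).2
        (by rw [Finset.card_univ]; exact h1) i (Finset.mem_univ _) j (Finset.mem_univ _)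
    simpa using this
  · rintro ⟨r, f, hcard, hf⟩ x -
    have hsurj : Function.Surjective f := fun i => by
      have hp : 0 < (Finset.univ.filter fun v => f v = i).card := by
        rw [hcard i (f (Classical.arbitrary V))]
        exact Finset.card_pos.2 ⟨Classical.arbitrary V, by simp⟩
      obtain ⟨v, hv⟩ := Finset.card_pos.1 hp
      exact ⟨v, (Finset.mem_filter.1 hv).2⟩
    have hw : cliqueNum G = r := by
      rw [cliqueNum_multipartite G f hf hsurj, Fintype.card_fin]
    have hr : (r : ℝ) ≠ 0 := by
      exact_mod_cast hw ▸ (cliqueNum_pos G).ne'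
    rw [← cliqueWeight_const, cliqueWeight_multipartite G f hf, hw, ← hpoly,
      ← Finset.sum_fiberwise Finset.univ f]
    simp only [Finset.sum_const, nsmul_eq_mul]
    set a := (Finset.univ.filter fun v => f v = f (Classical.arbitrary V)).card
    have ha : ∀ i, (Finset.univ.filter fun v => f v = i).card = a := fun i => hcard i _
    simp only [ha, Finset.prod_const, Finset.sum_const, Finset.card_univ, Fintype.card_fin,
      nsmul_eq_mul]
    rw [mul_div_cancel_left₀ _ hr]
end
end

section
/- Let G be a d-regular finite simple graph on n vertices with d ≥ 1. Then for every real x ≥ 0, I(G,x)^{2d} ≤ (2(1+x)^d − 1)^n. -/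
noncomputable section

/-- `s_k(G)`: the number of independent sets of size `k` in `G`
(= cliques of size `k` in the complement), with `s_0(G) = 1`. -/
def indepCount {V : Type*} [Fintype V] (G : SimpleGraph V) (k : ℕ) : ℕ :=
  Nat.card {s : Finset V // Gᶜ.IsNClique k s}

/-- The independence polynomial `I(G,x) = ∑_k s_k(G) x^k`, evaluated at `x`. -/
def indepPolyEval {V : Type*} [Fintype V] (G : SimpleGraph V) (x : ℝ) : ℝ :=
  ∑ k ∈ Finset.range (Fintype.card V + 1), (indepCount G k : ℝ) * x ^ k

/-- The AM-GM inequality for a product of exactly `d` factors, in power form. -/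
lemma prod_le_sum_pow_div {ι : Type*} (s : Finset ι) {d : ℕ} (hd : d ≠ 0) (hs : s.card = d)
    (a : ι → ℝ) (ha : ∀ i ∈ s, 0 ≤ a i) :
    ∏ i ∈ s, a i ≤ (∑ i ∈ s, a i ^ d) / d := by
  have hd' : (d : ℝ) ≠ 0 := by exact_mod_cast hd
  have key := Real.geom_mean_le_arith_mean_weighted s (fun _ => (d : ℝ)⁻¹) (fun i => a i ^ d)
    (fun _ _ => by positivity) (by simp [hs, hd']) (fun i hi => pow_nonneg (ha i hi) d)
  rw [← Finset.mul_sum, inv_mul_eq_div] at key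
  refine le_of_eq_of_le (Finset.prod_congr rfl fun i hi => ?_) key
  exact (Real.pow_rpow_inv_natCast (ha i hi) hd).symm

/-- Hölder's inequality for `d` positive functions on a two-point space with masses `1`, `x`. -/
lemma prod_add_mul_prod_le_prod {ι : Type*} (s : Finset ι) {d : ℕ} (hd : d ≠ 0)
    (hs : s.card = d) (a b g : ι → ℝ) (ha : ∀ i, 0 < a i) (hb : ∀ i, 0 < b i)
    (hg : ∀ i, 0 < g i) {x : ℝ} (hx : 0 ≤ x) (h : ∀ i ∈ s, g i ^ d = a i ^ d + x * b i ^ d) :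
    ∏ i ∈ s, a i + x * ∏ i ∈ s, b i ≤ ∏ i ∈ s, g i := by
  have hd' : (d : ℝ) ≠ 0 := by exact_mod_cast hd
  have hG : 0 < ∏ i ∈ s, g i := Finset.prod_pos fun i _ => hg i
  have h₁ := prod_le_sum_pow_div s hd hs (fun i => a i / g i)
    (fun i _ => (div_pos (ha i) (hg i)).le)
  have h₂ := prod_le_sum_pow_div s hd hs (fun i => b i / g i)
    (fun i _ => (div_pos (hb i) (hg i)).le)
  have hsum : ∑ i ∈ s, (a i / g i) ^ d + x * ∑ i ∈ s, (b i / g i) ^ d = d := by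
    rw [Finset.mul_sum, ← Finset.sum_add_distrib, Finset.sum_congr rfl (g := fun _ => (1 : ℝ))]
    · simp [hs]
    · intro i hi
      have : g i ^ d ≠ 0 := (pow_pos (hg i) d).ne'
      rw [div_pow, div_pow, mul_div_assoc', ← add_div, ← h i hi, div_self this]
  rw [Finset.prod_div_distrib] at h₁ h₂
  rw [← div_le_one hG, add_div, mul_div_assoc]
  calc _ ≤ _ := add_le_add h₁ (mul_le_mul_of_nonneg_left h₂ hx)
    _ = 1 := by rw [mul_div_assoc', ← add_div, hsum, div_self hd']

/-- Finner's inequality on a product of two-point spaces: if `f b` depends only on the coordinates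
in `N b` and every coordinate lies in exactly `d` of the sets `N b`, then the integral of
`∏ b, f b` is at most the product of the `L^d` norms of the `f b`. -/
lemma finner_inequality {V β : Type*} [DecidableEq V] [Fintype β] (N : β → Finset V) {d : ℕ}
    (hd : d ≠ 0) {x : ℝ} (hx : 0 ≤ x) (A : Finset V)
    (hA : ∀ a ∈ A, (Finset.univ.filter fun b => a ∈ N b).card = d)
    (f : β → Finset V → ℝ) (hf : ∀ b S, 0 < f b S)
    (hN : ∀ b a S, a ∉ N b → f b (insert a S) = f b S) :
    (∑ S ∈ A.powerset, x ^ S.card * ∏ b, f b S) ^ d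
      ≤ ∏ b, ∑ S ∈ (A ∩ N b).powerset, x ^ S.card * f b S ^ d := by
  induction A using Finset.induction_on generalizing f with
  | empty => simp [Finset.prod_pow]
  | insert a A ha ih =>
    let g : β → Finset V → ℝ := fun b S =>
      if a ∈ N b then (f b S ^ d + x * f b (insert a S) ^ d) ^ ((d : ℝ)⁻¹) else f b S
    have hpos : ∀ b S, 0 < f b S ^ d + x * f b (insert a S) ^ d := fun b S =>
      add_pos_of_pos_of_nonneg (pow_pos (hf b S) d) (mul_nonneg hx (pow_pos (hf b _) d).le)
    have hg : ∀ b S, 0 < g b S := by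
      intro b S
      by_cases h : a ∈ N b
      · simpa only [g, if_pos h] using Real.rpow_pos_of_pos (hpos b S) _
      · simpa only [g, if_neg h] using hf b S
    have hgd : ∀ b S, a ∈ N b → g b S ^ d = f b S ^ d + x * f b (insert a S) ^ d := by
      intro b S h
      simp only [g, if_pos h]
      exact Real.rpow_inv_natCast_pow (hpos b S).le hd
    have hgN : ∀ b c S, c ∉ N b → g b (insert c S) = g b S := by
      intro b c S h
      simp only [g, Finset.insert_comm a c, hN b c _ h]
    have hsplit : ∀ (B : Finset V) (F : Finset V → ℝ), a ∉ B →
        ∑ S ∈ (insert a B).powerset, x ^ S.card * F S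
          = ∑ S ∈ B.powerset, x ^ S.card * (F S + x * F (insert a S)) := by
      intro B F hB
      rw [Finset.sum_powerset_insert hB, ← Finset.sum_add_distrib]
      refine Finset.sum_congr rfl fun S hS => ?_
      rw [Finset.card_insert_of_notMem fun h => hB (Finset.mem_powerset.1 hS h)]
      ring
    have hstep : ∀ S, ∏ b, f b S + x * ∏ b, f b (insert a S) ≤ ∏ b, g b S := by
      intro S
      have hout : ∀ F : β → ℝ, ∏ b, F b = (∏ b with a ∈ N b, F b) * ∏ b with a ∉ N b, F b :=
        fun F => (Finset.prod_filter_mul_prod_filter_not _ _ _).symm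
      have h₁ : ∏ b with a ∉ N b, f b (insert a S) = ∏ b with a ∉ N b, f b S :=
        Finset.prod_congr rfl fun b hb => hN b a S (Finset.mem_filter.1 hb).2
      have h₂ : ∏ b with a ∉ N b, g b S = ∏ b with a ∉ N b, f b S :=
        Finset.prod_congr rfl fun b hb => if_neg (Finset.mem_filter.1 hb).2
      rw [hout, hout fun b => f b (insert a S), hout fun b => g b S, h₁, h₂, ← mul_assoc,
        ← add_mul]
      refine mul_le_mul_of_nonneg_right ?_ (Finset.prod_pos fun b _ => hf b S).le
      exact prod_add_mul_prod_le_prod _ hd (hA a (Finset.mem_insert_self a A)) _ _ _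
        (fun b => hf b S) (fun b => hf b _) (fun b => hg b S) hx
        fun b hb => hgd b S (Finset.mem_filter.1 hb).2
    calc (∑ S ∈ (insert a A).powerset, x ^ S.card * ∏ b, f b S) ^ d
        ≤ (∑ S ∈ A.powerset, x ^ S.card * ∏ b, g b S) ^ d := by
          rw [hsplit A _ ha]
          refine pow_le_pow_left₀ (Finset.sum_nonneg fun S _ => mul_nonneg (by positivity) ?_)
            (Finset.sum_le_sum fun S _ => mul_le_mul_of_nonneg_left (hstep S) (by positivity)) d
          exact add_nonneg (Finset.prod_pos fun b _ => hf b S).le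
            (mul_nonneg hx (Finset.prod_pos fun b _ => hf b _).le)
      _ ≤ ∏ b, ∑ S ∈ (A ∩ N b).powerset, x ^ S.card * g b S ^ d :=
          ih (fun c hc => hA c (Finset.mem_insert_of_mem hc)) g hg hgN
      _ = _ := by
          refine Finset.prod_congr rfl fun b _ => ?_
          by_cases h : a ∈ N b
          · rw [Finset.insert_inter_of_mem h,
              hsplit _ _ fun h' => ha (Finset.mem_inter.1 h').1]
            simp only [hgd b _ h]
          · rw [Finset.insert_inter_of_notMem h]
            simp only [g, if_neg h]

lemma sum_powerset_pow_card {V : Type*} (A : Finset V) (x : ℝ) :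
    ∑ S ∈ A.powerset, x ^ S.card = (1 + x) ^ A.card := by
  simpa [add_comm] using Finset.sum_pow_mul_eq_add_pow x 1 A

lemma indepPolyEval_eq_sum {V : Type*} [Fintype V] [DecidableEq V] (G : SimpleGraph V)
    [DecidablePred fun A : Finset V => ∀ u ∈ A, ∀ v ∈ A, ¬ G.Adj u v] (x : ℝ) :
    indepPolyEval G x
      = ∑ A : Finset V with ∀ u ∈ A, ∀ v ∈ A, ¬ G.Adj u v, x ^ A.card := by
  classical
  have hmaps : ∀ A ∈ (Finset.univ.filter fun A : Finset V => ∀ u ∈ A, ∀ v ∈ A, ¬ G.Adj u v),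
      A.card ∈ Finset.range (Fintype.card V + 1) :=
    fun A _ => Finset.mem_range_succ_iff.2 A.card_le_univ
  rw [indepPolyEval, ← Finset.sum_fiberwise_of_maps_to hmaps]
  refine Finset.sum_congr rfl fun k _ => ?_
  rw [Finset.sum_congr rfl (g := fun _ => x ^ k) fun A hA => by rw [(Finset.mem_filter.1 hA).2],
    Finset.sum_const, nsmul_eq_mul, indepCount, Nat.card_eq_fintype_card, Fintype.card_subtype]
  congr 3
  ext A
  simp only [Finset.mem_filter, Finset.mem_univ, true_and, SimpleGraph.isNClique_iff,
    SimpleGraph.isClique_iff, Set.Pairwise, SimpleGraph.compl_adj, Finset.mem_coe]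
  refine and_congr_left fun _ => ⟨fun h u hu v hv huv => (h hu hv huv.ne).2 huv,
    fun h u hu v hv huv => ⟨huv, h u hu v hv⟩⟩

/-- Zhao's bipartite swapping inequality, counting with prescribed union and intersection: the
pairs of independent sets are at most as many as the pairs with no edge between them. -/
lemma card_indep_pairs_le {V : Type*} [Fintype V] [DecidableEq V] (G : SimpleGraph V)
    [DecidableRel G.Adj] (U I : Finset V) :
    (Finset.univ.filter fun p : Finset V × Finset V =>
        ((∀ u ∈ p.1, ∀ v ∈ p.1, ¬ G.Adj u v) ∧ ∀ u ∈ p.2, ∀ v ∈ p.2, ¬ G.Adj u v) ∧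
          (p.1 ∪ p.2, p.1 ∩ p.2) = (U, I)).card
      ≤ (Finset.univ.filter fun p : Finset V × Finset V =>
        (∀ u ∈ p.1, ∀ v ∈ p.2, ¬ G.Adj u v) ∧ (p.1 ∪ p.2, p.1 ∩ p.2) = (U, I)).card := by
  rcases Finset.eq_empty_or_nonempty (Finset.univ.filter fun p : Finset V × Finset V =>
        ((∀ u ∈ p.1, ∀ v ∈ p.1, ¬ G.Adj u v) ∧ ∀ u ∈ p.2, ∀ v ∈ p.2, ¬ G.Adj u v) ∧
          (p.1 ∪ p.2, p.1 ∩ p.2) = (U, I)) with h | ⟨⟨A₀, B₀⟩, h⟩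
  · exact h ▸ Nat.zero_le _
  simp only [Finset.mem_filter, Finset.mem_univ, true_and, Prod.mk.injEq, Finset.ext_iff,
    Finset.mem_union, Finset.mem_inter] at h
  obtain ⟨⟨hA₀, hB₀⟩, hU₀, hI₀⟩ := h
  refine Finset.card_le_card_of_injOn
    (fun p => (I ∪ symmDiff p.1 A₀, I ∪ symmDiff p.1 B₀)) ?_ ?_
  · rintro ⟨A, B⟩ h
    simp only [Finset.coe_filter, Set.mem_ofPred_eq, Finset.mem_univ, true_and, Prod.mk.injEq,
      Finset.ext_iff, Finset.mem_union, Finset.mem_inter, Finset.mem_symmDiff] at h ⊢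
    obtain ⟨⟨hA, hB⟩, hU, hI⟩ := h
    refine ⟨fun u hu v hv huv => ?_, fun v => ?_, fun v => ?_⟩
    · have := hA u
      have := hB u
      have := hA₀ u
      have := hB₀ u
      grind
    · grind
    · grind
  · rintro ⟨A, B⟩ h ⟨A', B'⟩ h' heq
    simp only [Finset.coe_filter, Set.mem_ofPred_eq, Finset.mem_univ, true_and, Prod.mk.injEq,
      Finset.ext_iff, Finset.mem_union, Finset.mem_inter, Finset.mem_symmDiff] at h h' heq ⊢
    obtain ⟨-, hU, hI⟩ := h
    obtain ⟨-, hU', hI'⟩ := h'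
    obtain ⟨h₁, h₂⟩ := heq
    have hAA : ∀ v, v ∈ A ↔ v ∈ A' := fun v => by
      have := h₁ v
      have := hI v
      have := hI' v
      have := hU v
      have := hU' v
      have := hU₀ v
      have := hI₀ v
      grind
    refine ⟨hAA, fun v => ?_⟩
    have := hAA v
    have := hI v
    have := hI' v
    have := hU v
    have := hU' v
    grind

/-- Zhao's inequality: the square of the independence polynomial of `G` is at most the independence
polynomial of the bipartite double cover of `G`. -/
lemma indepPolyEval_sq_le {V : Type*} [Fintype V] [DecidableEq V] (G : SimpleGraph V)
    [DecidableRel G.Adj] {x : ℝ} (hx : 0 ≤ x) :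
    indepPolyEval G x ^ 2
      ≤ ∑ p : Finset V × Finset V with ∀ u ∈ p.1, ∀ v ∈ p.2, ¬ G.Adj u v,
          x ^ (p.1.card + p.2.card) := by
  rw [indepPolyEval_eq_sum, sq, Finset.sum_mul_sum, ← Finset.sum_product', ← Finset.filter_product,
    Finset.univ_product_univ]
  simp only [← pow_add]
  rw [← Finset.sum_fiberwise _ fun p : Finset V × Finset V => (p.1 ∪ p.2, p.1 ∩ p.2)]
  conv_rhs => rw [← Finset.sum_fiberwise _ fun p : Finset V × Finset V => (p.1 ∪ p.2, p.1 ∩ p.2)]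
  refine Finset.sum_le_sum fun ⟨U, I⟩ _ => ?_
  have hconst : ∀ s : Finset (Finset V × Finset V),
      ∑ p ∈ s with (p.1 ∪ p.2, p.1 ∩ p.2) = (U, I), x ^ (p.1.card + p.2.card)
        = (s.filter fun p => (p.1 ∪ p.2, p.1 ∩ p.2) = (U, I)).card * x ^ (U.card + I.card) := by
    intro s
    rw [← nsmul_eq_mul, ← Finset.sum_const]
    refine Finset.sum_congr rfl fun p hp => ?_
    obtain ⟨rfl, rfl⟩ := Prod.mk.inj (Finset.mem_filter.1 hp).2
    rw [Finset.card_union_add_card_inter]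
  rw [hconst, hconst, Finset.filter_filter, Finset.filter_filter]
  refine mul_le_mul_of_nonneg_right ?_ (by positivity)
  exact_mod_cast card_indep_pairs_le G U I

lemma sum_cross_nonadj_eq {V : Type*} [Fintype V] [DecidableEq V] (G : SimpleGraph V)
    [DecidableRel G.Adj] (x : ℝ) :
    ∑ p : Finset V × Finset V with ∀ u ∈ p.1, ∀ v ∈ p.2, ¬ G.Adj u v, x ^ (p.1.card + p.2.card)
      = ∑ S : Finset V, x ^ S.card *
          ∏ v, if Disjoint S (G.neighborFinset v) then 1 + x else 1 := by
  rw [Finset.sum_filter, ← Finset.univ_product_univ, Finset.sum_product]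
  refine Finset.sum_congr rfl fun S _ => ?_
  rw [← Finset.prod_filter, Finset.prod_const, ← sum_powerset_pow_card, Finset.mul_sum,
    ← Finset.sum_filter]
  refine Finset.sum_congr ?_ fun T _ => pow_add x _ _
  ext T
  simp only [Finset.mem_filter, Finset.mem_univ, true_and, Finset.mem_powerset,
    Finset.subset_iff, Finset.disjoint_left, SimpleGraph.mem_neighborFinset]
  exact ⟨fun h v hv u hu huv => h u hu v hv huv.symm, fun h u hu v hv huv => h hv hu huv.symm⟩

lemma sum_powerset_disjoint_pow {V : Type*} [DecidableEq V] (N : Finset V) {d : ℕ}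
    (hN : N.card = d) (x : ℝ) :
    ∑ S ∈ N.powerset, x ^ S.card * (if Disjoint S N then 1 + x else 1) ^ d
      = 2 * (1 + x) ^ d - 1 := by
  have h : ∀ S ∈ N.powerset, x ^ S.card * (if Disjoint S N then 1 + x else 1) ^ d
      = x ^ S.card + if S = ∅ then (1 + x) ^ d - 1 else 0 := by
    intro S hS
    have hdisj : Disjoint S N ↔ S = ∅ :=
      ⟨fun h => Finset.disjoint_self_iff_empty S |>.1 (h.mono_right (Finset.mem_powerset.1 hS)),
        fun h => h ▸ Finset.disjoint_empty_left N⟩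
    simp only [hdisj]
    split_ifs with h
    · simp [h]
    · simp
  rw [Finset.sum_congr rfl h, Finset.sum_add_distrib, sum_powerset_pow_card, hN,
    Finset.sum_ite_eq', if_pos (Finset.empty_mem_powerset N)]
  ring

/-- For a `d`-regular graph `G` on `n` vertices and `x ≥ 0`:
`I(G,x)^{2d} ≤ (2(1+x)^d - 1)^n`. -/
theorem stmt_7 {V : Type*} [Fintype V] (G : SimpleGraph V) [DecidableRel G.Adj]
    (d : ℕ) (hd : 1 ≤ d) (hreg : G.IsRegularOfDegree d) :
    ∀ x : ℝ, 0 ≤ x →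
      (indepPolyEval G x) ^ (2 * d)
        ≤ (2 * (1 + x) ^ d - 1) ^ (Fintype.card V) := by
  classical
  intro x hx
  have hcard : ∀ v, (G.neighborFinset v).card = d := hreg
  have hfinner := finner_inequality (fun v => G.neighborFinset v) (Nat.one_le_iff_ne_zero.1 hd) hx Finset.univ
    (fun a _ => by
      rw [← hcard a]
      congr 1
      ext b
      simp [G.adj_comm])
    (fun v S => if Disjoint S (G.neighborFinset v) then 1 + x else 1)
    (fun v S => by split_ifs <;> positivity)
    (fun v a S ha => by simp only [Finset.disjoint_insert_left, ha, not_false_iff, true_and])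
  simp only [Finset.powerset_univ, Finset.univ_inter,
    fun v => sum_powerset_disjoint_pow (G.neighborFinset v) (hcard v) x, Finset.prod_const,
    Finset.card_univ] at hfinner
  rw [pow_mul]
  refine (pow_le_pow_left₀ (sq_nonneg _) (indepPolyEval_sq_le G hx) d).trans ?_
  rwa [sum_cross_nonadj_eq]
end
end

section
/- Let G be a d-regular finite simple graph on n vertices with d ≥ 1, and let i(G) denote the total number of independent sets of G (including the empty set). Then i(G)^{2d} ≤ (2^{d+1} − 1)^n. -/
noncomputable section

/-- `i(G)`: the total number of independent sets of `G` (including the empty set),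
i.e. the number of finsets of vertices that are cliques of the complement. -/
def indepSetCount {V : Type*} [Fintype V] (G : SimpleGraph V) : ℕ :=
  Nat.card {s : Finset V // Gᶜ.IsClique (s : Set V)}

open scoped NNReal in
/-- Hölder's inequality for a two-point space: the geometric mean is superadditive. -/
theorem NNReal.prod_add_prod_le_prod_of_pow_eq {J : Type*} (s : Finset J) (x y z : J → ℝ≥0)
    (hs : s.Nonempty) (hz : ∀ j ∈ s, z j ^ s.card = x j ^ s.card + y j ^ s.card) :
    ∏ j ∈ s, x j + ∏ j ∈ s, y j ≤ ∏ j ∈ s, z j := by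
  have hc : s.card ≠ 0 := hs.card_ne_zero
  by_cases h0 : ∃ j ∈ s, z j = 0
  · obtain ⟨j, hj, hj0⟩ := h0
    have h := hz j hj
    rw [hj0, zero_pow hc, eq_comm, add_eq_zero, pow_eq_zero_iff hc, pow_eq_zero_iff hc] at h
    simp [Finset.prod_eq_zero hj h.1, Finset.prod_eq_zero hj h.2]
  push Not at h0
  have hw : ∑ _j ∈ s, ((s.card : ℝ≥0)⁻¹) = 1 := by
    rw [Finset.sum_const, nsmul_eq_mul, mul_inv_cancel₀ (by exact_mod_cast hc)]
  have amgm (u : J → ℝ≥0) :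
      ∏ j ∈ s, u j ≤ ∑ j ∈ s, (s.card : ℝ≥0)⁻¹ * u j ^ s.card := by
    have h := NNReal.geom_mean_le_arith_mean_weighted s (fun _ => (s.card : ℝ≥0)⁻¹)
      (fun j => u j ^ s.card) hw
    simpa only [NNReal.coe_inv, NNReal.coe_natCast, NNReal.pow_rpow_inv_natCast _ hc] using h
  have hpos : 0 < ∏ j ∈ s, z j := Finset.prod_pos fun j hj => pos_iff_ne_zero.2 (h0 j hj)
  rw [← div_le_one hpos, add_div, ← Finset.prod_div_distrib, ← Finset.prod_div_distrib]
  refine (add_le_add (amgm _) (amgm _)).trans ?_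
  rw [← Finset.sum_add_distrib, ← hw]
  refine (Finset.sum_congr rfl fun j hj => ?_).le
  rw [← mul_add, div_pow, div_pow, ← add_div, ← hz j hj, div_self (pow_ne_zero _ (h0 j hj)),
    mul_one]

open scoped NNReal in
/-- **Finner's inequality** on a discrete cube: if every coordinate in `s` lies in exactly `d` of
the sets `N j`, then the product of functions depending only on the coordinates in `N j` satisfies
Hölder's inequality with all exponents equal to `d`. -/
theorem Finset.sum_powerset_prod_pow_le {ι J : Type*} [DecidableEq ι] (t : Finset J)
    (N : J → Finset ι) (d : ℕ) (hd : d ≠ 0) (s : Finset ι)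
    (hN : ∀ i ∈ s, (t.filter fun j => i ∈ N j).card = d) (F : J → Finset ι → ℝ≥0) :
    (∑ S ∈ s.powerset, ∏ j ∈ t, F j (S ∩ N j)) ^ d ≤
      ∏ j ∈ t, ∑ T ∈ (s ∩ N j).powerset, F j T ^ d := by
  induction s using Finset.induction_on generalizing F with
  | empty => simp [Finset.prod_pow]
  | insert a s ha ih =>
    let G : J → Finset ι → ℝ≥0 := fun j T =>
      if a ∈ N j then (F j T ^ d + F j (insert a T) ^ d) ^ ((d : ℝ)⁻¹) else F j T
    have key : ∑ S ∈ (insert a s).powerset, ∏ j ∈ t, F j (S ∩ N j) ≤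
        ∑ S ∈ s.powerset, ∏ j ∈ t, G j (S ∩ N j) := by
      rw [Finset.sum_powerset_insert ha, ← Finset.sum_add_distrib]
      refine Finset.sum_le_sum fun S _ => ?_
      rw [← Finset.prod_filter_mul_prod_filter_not t (fun j => a ∈ N j),
        ← Finset.prod_filter_mul_prod_filter_not t (fun j => a ∈ N j)
          (fun j => F j (insert a S ∩ N j)),
        ← Finset.prod_filter_mul_prod_filter_not t (fun j => a ∈ N j)
          (fun j => G j (S ∩ N j))]
      have h1 : ∏ j ∈ t with a ∉ N j, F j (insert a S ∩ N j) =
          ∏ j ∈ t with a ∉ N j, F j (S ∩ N j) :=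
        Finset.prod_congr rfl fun j hj => by
          rw [Finset.insert_inter_of_notMem (Finset.mem_filter.1 hj).2]
      have h2 : ∏ j ∈ t with a ∉ N j, G j (S ∩ N j) =
          ∏ j ∈ t with a ∉ N j, F j (S ∩ N j) :=
        Finset.prod_congr rfl fun j hj => if_neg (Finset.mem_filter.1 hj).2
      rw [h1, h2, ← add_mul]
      have hcard := hN a (Finset.mem_insert_self a s)
      refine mul_le_mul_left (NNReal.prod_add_prod_le_prod_of_pow_eq _ _ _ _
        (Finset.card_ne_zero.1 (hcard ▸ hd)) fun j hj => ?_) _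
      have haj := (Finset.mem_filter.1 hj).2
      simp only [G, hcard, if_pos haj, Finset.insert_inter_of_mem haj,
        NNReal.rpow_inv_natCast_pow _ hd]
    refine (pow_le_pow_left' key d).trans
      ((ih (fun i hi => hN i (Finset.mem_insert_of_mem hi)) G).trans
        (Finset.prod_congr rfl fun j _ => ?_).le)
    by_cases haj : a ∈ N j
    · rw [Finset.insert_inter_of_mem haj, Finset.sum_powerset_insert (by simp [ha]),
        ← Finset.sum_add_distrib]
      simp only [G, if_pos haj, NNReal.rpow_inv_natCast_pow _ hd]
    · simp only [G, if_neg haj, Finset.insert_inter_of_notMem haj]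

/-- Independent sets of the bipartite double cover of `G`: pairs of vertex sets of `G` with no edge
between them. -/
abbrev SimpleGraph.NonAdjPair {V : Type*} (G : SimpleGraph V) : Type _ :=
  {p : Finset V × Finset V // ∀ a ∈ p.1, ∀ b ∈ p.2, ¬ G.Adj a b}

/-- Zhao's bipartite swapping trick: `i(G)²` is at most the number of independent sets of the
bipartite double cover. For each intersection and union of two independent sets, fix a reference
pair `(A₀, B₀)`; a pair `(A, B)` with these data is sent to the pair obtained by distributing the
vertices of `A ∆ B` according to membership in `A ∆ A₀`. -/
theorem indepSetCount_sq_le {V : Type*} [Fintype V] (G : SimpleGraph V) :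
    indepSetCount G ^ 2 ≤ Nat.card G.NonAdjPair := by
  classical
  let I := {s : Finset V // Gᶜ.IsClique (s : Set V)}
  have hI (s : I) {a b : V} (ha : a ∈ s.1) (hb : b ∈ s.1) : ¬ G.Adj a b := fun h =>
    (s.2 (Finset.mem_coe.2 ha) (Finset.mem_coe.2 hb) h.ne).2 h
  let key (p : I × I) : Finset V × Finset V := (p.1.1 ∩ p.2.1, p.1.1 ∪ p.2.1)
  have hkey₁ (p : I × I) (a : V) : a ∈ (key p).1 ↔ a ∈ p.1.1 ∧ a ∈ p.2.1 := Finset.mem_inter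
  have hkey₂ (p : I × I) (a : V) : a ∈ (key p).2 ↔ a ∈ p.1.1 ∨ a ∈ p.2.1 := Finset.mem_union
  obtain ⟨ref, hrefkey⟩ : ∃ ref : Finset V × Finset V → I × I, ∀ p, key (ref (key p)) = key p :=
    ⟨fun k => if h : ∃ p, key p = k then h.choose else (⟨∅, by simp⟩, ⟨∅, by simp⟩), fun p => by
      have h : ∃ q, key q = key p := ⟨p, rfl⟩
      beta_reduce
      rw [dif_pos h]
      exact h.choose_spec⟩
  have hcap (p : I × I) (a : V) :
      (a ∈ (ref (key p)).1.1 ∧ a ∈ (ref (key p)).2.1) ↔ (a ∈ p.1.1 ∧ a ∈ p.2.1) := by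
    simpa [key] using Finset.ext_iff.1 (congrArg Prod.fst (hrefkey p)) a
  have hcup (p : I × I) (a : V) :
      (a ∈ (ref (key p)).1.1 ∨ a ∈ (ref (key p)).2.1) ↔ (a ∈ p.1.1 ∨ a ∈ p.2.1) := by
    simpa [key] using Finset.ext_iff.1 (congrArg Prod.snd (hrefkey p)) a
  let X (p : I × I) : Finset V := symmDiff p.1.1 (ref (key p)).1.1
  let f (p : I × I) : G.NonAdjPair :=
    ⟨((key p).1 ∪ ((key p).2 \ X p), (key p).1 ∪ ((key p).2 ∩ X p)), by
      intro a ha b hb hab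
      have h1 := hcap p a
      have h2 := hcap p b
      have h3 := hcup p a
      have h4 := hcup p b
      have h5 := fun ha hb => hI p.1 (a := a) (b := b) ha hb hab
      have h6 := fun ha hb => hI p.2 (a := a) (b := b) ha hb hab
      have h7 := fun ha hb => hI (ref (key p)).1 (a := a) (b := b) ha hb hab
      have h8 := fun ha hb => hI (ref (key p)).2 (a := a) (b := b) ha hb hab
      simp only [X, Finset.mem_union, Finset.mem_inter, Finset.mem_sdiff,
        Finset.mem_symmDiff] at ha hb
      rw [hkey₁, hkey₂] at ha hb
      clear hkey₁ hkey₂ hcap hcup hI hrefkey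
      generalize ref (key p) = r at *
      clear_value X key
      grind (splits := 30)⟩
  have hf : Function.Injective f := by
    intro p q hpq
    have e1 (a : V) := Finset.ext_iff.1 (congrArg (fun r => r.1.1) hpq) a
    have e2 (a : V) := Finset.ext_iff.1 (congrArg (fun r => r.1.2) hpq) a
    simp only [f, X, Finset.mem_union, Finset.mem_inter, Finset.mem_sdiff,
      Finset.mem_symmDiff, hkey₁, hkey₂] at e1 e2
    have hkey : key p = key q := by
      refine Prod.ext (Finset.ext fun a => ?_) (Finset.ext fun a => ?_)
      all_goals
        have h1 := hcap p a
        have h2 := hcap q a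
        have e1 := e1 a
        have e2 := e2 a
        simp only [hkey₁, hkey₂]
        clear hkey₁ hkey₂ hcap hcup hI hrefkey hpq f
        generalize ref (key p) = r at *
        generalize ref (key q) = r' at *
        clear_value X key
        grind (splits := 30)
    have hc (a : V) : (a ∈ p.1.1 ∧ a ∈ p.2.1) ↔ (a ∈ q.1.1 ∧ a ∈ q.2.1) := by
      rw [← hkey₁, ← hkey₁, hkey]
    have hu (a : V) : (a ∈ p.1.1 ∨ a ∈ p.2.1) ↔ (a ∈ q.1.1 ∨ a ∈ q.2.1) := by
      rw [← hkey₂, ← hkey₂, hkey]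
    rw [← hkey] at e1 e2
    refine Prod.ext (Subtype.ext (Finset.ext fun a => ?_)) (Subtype.ext (Finset.ext fun a => ?_))
    all_goals
      have hc := hc a
      have hu := hu a
      have hr := hcap p a
      have e1 := e1 a
      have e2 := e2 a
      clear hkey hkey₁ hkey₂ hcap hcup hI hrefkey hpq f
      generalize ref (key p) = r at *
      clear_value X key
      grind (splits := 30)
  have := Nat.card_le_card_of_injective f hf
  rwa [Nat.card_prod, ← sq] at this

/-- Counting independent sets of the bipartite double cover by their first component. -/
theorem SimpleGraph.card_nonAdjPair {V : Type*} [Fintype V] [DecidableEq V] (G : SimpleGraph V)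
    [DecidableRel G.Adj] :
    Nat.card G.NonAdjPair = ∑ S : Finset V, ∏ v : V,
      if S ∩ G.neighborFinset v = ∅ then 2 else 1 := by
  have e : G.NonAdjPair ≃ Σ S : Finset V,
      (Finset.univ.filter fun v => S ∩ G.neighborFinset v = ∅).powerset :=
    { toFun := fun p => ⟨p.1.1, p.1.2, by
        refine Finset.mem_powerset.2 fun b hb => Finset.mem_filter.2 ⟨Finset.mem_univ b, ?_⟩
        refine Finset.eq_empty_of_forall_notMem fun a ha => ?_
        rw [Finset.mem_inter, G.mem_neighborFinset] at ha
        exact p.2 a ha.1 b hb ha.2.symm⟩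
      invFun := fun q => ⟨(q.1, q.2.1), fun a ha b hb hab => by
        have h := (Finset.mem_filter.1 (Finset.mem_powerset.1 q.2.2 hb)).2
        refine Finset.notMem_empty a (h ▸ Finset.mem_inter.2 ⟨ha, ?_⟩)
        exact (G.mem_neighborFinset b a).2 hab.symm⟩
      left_inv := fun _ => rfl
      right_inv := fun _ => rfl }
  rw [Nat.card_congr e, Nat.card_eq_fintype_card, Fintype.card_sigma]
  refine Finset.sum_congr rfl fun S _ => ?_
  rw [Fintype.card_coe, Finset.card_powerset, Finset.prod_ite]
  simp

/-- For a `d`-regular graph `G` on `n` vertices: `i(G)^{2d} ≤ (2^{d+1} - 1)^n`. -/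
theorem stmt_8 {V : Type*} [Fintype V] (G : SimpleGraph V) [DecidableRel G.Adj]
    (d : ℕ) (hd : 1 ≤ d) (hreg : G.IsRegularOfDegree d) :
    (indepSetCount G) ^ (2 * d) ≤ (2 ^ (d + 1) - 1) ^ (Fintype.card V) := by
  classical
  have hd0 : d ≠ 0 := by lia
  rw [pow_mul]
  refine (Nat.pow_le_pow_left (indepSetCount_sq_le G) d).trans ?_
  have hN : ∀ i ∈ (Finset.univ : Finset V),
      (Finset.univ.filter fun j => i ∈ G.neighborFinset j).card = d := fun i _ => by
    rw [← hreg i, ← G.card_neighborFinset_eq_degree]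
    congr 1
    ext j
    simp [G.adj_comm]
  have h := Finset.sum_powerset_prod_pow_le Finset.univ (fun v => G.neighborFinset v) d hd0
    Finset.univ hN (fun _ T => if T = ∅ then 2 else 1)
  have hsum (v : V) : ∑ T ∈ (Finset.univ ∩ G.neighborFinset v).powerset,
      (if T = ∅ then (2 : NNReal) else 1) ^ d = ((2 ^ (d + 1) - 1 : ℕ) : NNReal) := by
    rw [Finset.univ_inter, ← Finset.add_sum_erase _ _ (Finset.empty_mem_powerset _),
      Finset.sum_congr rfl (g := fun _ => 1) (fun T hT => by simp [(Finset.mem_erase.1 hT).1])]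
    rw [Finset.sum_const, Finset.card_erase_of_mem (Finset.empty_mem_powerset _),
      Finset.card_powerset, G.card_neighborFinset_eq_degree, hreg v, if_pos rfl, nsmul_one,
      pow_succ, mul_two, Nat.add_sub_assoc Nat.one_le_two_pow]
    push_cast
    rfl
  rw [Finset.prod_congr rfl fun v _ => hsum v, Finset.prod_const, Finset.card_univ,
    Finset.powerset_univ] at h
  rw [G.card_nonAdjPair]
  exact_mod_cast h
end
end

section
/- Let n ≥ 1 and let p ∈ (0,1) be real. Then all roots of the polynomial C(G_{n,p},x) are real and simple. Moreover, writing the n roots in ascending order r_n < r_{n−1} < … < r_1 < 0, one has p·r_{i+1} < r_i for every i = 1, …, n−1. -/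
noncomputable section

/-- The clique polynomial of the random graph:
`C(G_{n,p},x) = ∑_{k=0}^n C(n,k) p^{k(k-1)/2} x^k`. -/
def randCliquePoly (n : ℕ) (p : ℝ) : Polynomial ℝ :=
  ∑ k ∈ Finset.range (n + 1),
    Polynomial.C ((n.choose k : ℝ) * p ^ (k * (k - 1) / 2)) * Polynomial.X ^ k

open Finset Polynomial in
/-- The recursion `C(G_{n+1,p},x) = C(G_{n,p},x) + x C(G_{n,p},px)`. -/
theorem eval_randCliquePoly_succ (n : ℕ) (p x : ℝ) :
    (randCliquePoly (n + 1) p).eval x =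
      (randCliquePoly n p).eval x + x * (randCliquePoly n p).eval (p * x) := by
  simp only [randCliquePoly, eval_finsetSum, eval_mul, eval_C, eval_pow, eval_X]
  have hsplit : ∑ k ∈ range (n + 1), ((n.choose k : ℝ) * p ^ (k * (k - 1) / 2)) * x ^ k
      = 1 + ∑ k ∈ range (n + 1),
        ((n.choose (k + 1) : ℝ) * p ^ ((k + 1) * k / 2)) * x ^ (k + 1) := by
    have h := sum_range_succ'
      (fun k => ((n.choose k : ℝ) * p ^ (k * (k - 1) / 2)) * x ^ k) (n + 1)
    rw [sum_range_succ] at h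
    simp only [Nat.choose_succ_self, Nat.add_sub_cancel] at h
    simp at h
    linarith
  rw [hsplit, sum_range_succ', mul_sum, add_comm, add_assoc, ← sum_add_distrib]
  simp only [Nat.add_sub_cancel]
  congr 1
  · simp
  refine sum_congr rfl fun k _ => ?_
  have hexp : (k + 1) * k / 2 = k * (k - 1) / 2 + k := by
    rw [mul_comm, ← Nat.triangle_succ]
    simp [mul_comm]
  rw [hexp, Nat.choose_succ_succ]
  push_cast
  ring

open Polynomial in
theorem coeff_randCliquePoly_self (n : ℕ) (p : ℝ) :
    (randCliquePoly n p).coeff n = p ^ (n * (n - 1) / 2) := by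
  simp only [randCliquePoly, finsetSum_coeff, coeff_C_mul, coeff_X_pow]
  simp

open Polynomial in
theorem natDegree_randCliquePoly_le (n : ℕ) (p : ℝ) : (randCliquePoly n p).natDegree ≤ n :=
  natDegree_sum_le_of_forall_le _ _ fun k hk =>
    (natDegree_C_mul_X_pow_le _ k).trans (Nat.lt_succ_iff.mp (Finset.mem_range.mp hk))

theorem natDegree_randCliquePoly (n : ℕ) {p : ℝ} (hp : 0 < p) :
    (randCliquePoly n p).natDegree = n := by
  refine le_antisymm (natDegree_randCliquePoly_le n p) (Polynomial.le_natDegree_of_ne_zero ?_)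
  rw [coeff_randCliquePoly_self]
  positivity

theorem leadingCoeff_randCliquePoly (n : ℕ) {p : ℝ} (hp : 0 < p) :
    (randCliquePoly n p).leadingCoeff = p ^ (n * (n - 1) / 2) := by
  rw [Polynomial.leadingCoeff, natDegree_randCliquePoly n hp, coeff_randCliquePoly_self]

theorem eval_zero_randCliquePoly (n : ℕ) (p : ℝ) : (randCliquePoly n p).eval 0 = 1 := by
  induction n with
  | zero => simp [randCliquePoly]
  | succ n ih => simp [eval_randCliquePoly_succ, ih]

/-- A polynomial of degree `n` vanishing at `-b 0, …, -b (n - 1)`, pairwise distinct, factors. -/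
theorem Polynomial.eq_C_leadingCoeff_mul_prod_X_add_C {f : Polynomial ℝ} {n : ℕ}
    (hdeg : f.natDegree = n) (hf : f ≠ 0) {b : ℕ → ℝ}
    (hb : Set.InjOn b (Finset.range n)) (hroot : ∀ i < n, f.eval (-b i) = 0) :
    f = C f.leadingCoeff * ∏ i ∈ Finset.range n, (X + C (b i)) := by
  set s : Finset ℝ := (Finset.range n).image fun i => -b i with hs
  have hinj : Set.InjOn (fun i => -b i) (Finset.range n) := fun i hi j hj hij =>
    hb hi hj (neg_injective hij)
  have hcard : s.card = n := by rw [hs, Finset.card_image_of_injOn hinj, Finset.card_range]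
  have hle : s.val ≤ f.roots := by
    rw [Multiset.le_iff_subset s.nodup]
    intro x hx
    obtain ⟨i, hi, rfl⟩ := Finset.mem_image.mp (Finset.mem_val.mp hx)
    exact (mem_roots hf).mpr (hroot i (Finset.mem_range.mp hi))
  have hroots : s.val = f.roots :=
    Multiset.eq_of_le_of_card_le hle ((card_roots' f).trans (by rw [hdeg]; exact hcard.ge))
  have hprod := C_leadingCoeff_mul_prod_multiset_X_sub_C (p := f)
    (by rw [← hroots, hdeg]; exact hcard)
  have himage : ∏ x ∈ s, (X - C x) = ∏ i ∈ Finset.range n, (X + C (b i)) := by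
    rw [hs, Finset.prod_image hinj]
    simp
  rw [← himage, Finset.prod_eq_multiset_prod, hroots, hprod]

theorem neg_one_pow_mul_prod_sub_pos {a : ℕ → ℝ} {t : ℝ} {j n : ℕ} (hjn : j ≤ n)
    (hlt : ∀ i < j, a i < t) (hgt : ∀ i, j ≤ i → i < n → t < a i) :
    0 < (-1) ^ j * ∏ i ∈ Finset.range n, (a i - t) := by
  have hneg : (-1) ^ j * ∏ i ∈ Finset.range j, (a i - t) = ∏ i ∈ Finset.range j, (t - a i) := by
    have h := Finset.prod_mul_pow_card (s := Finset.range j) (f := fun i => a i - t) (b := (-1 : ℝ))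
    rw [Finset.card_range] at h
    rw [mul_comm, h]
    exact Finset.prod_congr rfl fun i _ => by ring
  rw [← Finset.prod_range_mul_prod_Ico _ hjn, ← mul_assoc, hneg]
  refine mul_pos (Finset.prod_pos fun i hi => sub_pos.mpr (hlt i (Finset.mem_range.mp hi)))
    (Finset.prod_pos fun i hi => ?_)
  rw [Finset.mem_Ico] at hi
  exact sub_pos.mpr (hgt i hi.1 hi.2)

theorem lt_of_forall_lt_mul_succ {a : ℕ → ℝ} {p : ℝ} {n : ℕ} (hp1 : p < 1)
    (hpos : ∀ i < n, 0 < a i) (hsep : ∀ i, i + 1 < n → a i < p * a (i + 1)) {i j : ℕ}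
    (hij : i < j) (hj : j < n) : a i < a j := by
  have hstep : ∀ k, k + 1 < n → a k < a (k + 1) := fun k hk =>
    (hsep k hk).trans (by nlinarith [hpos _ hk])
  induction j, hij using Nat.le_induction with
  | base => exact hstep i hj
  | succ k _ ih => exact (ih (by omega)).trans (hstep k hj)

/-- For large `t`, the sign of a polynomial at `-t` is governed by the parity of its degree. -/
theorem Polynomial.eventually_neg_one_pow_mul_eval_neg_pos {f : Polynomial ℝ}
    (hdeg : 0 < f.natDegree) (hlead : 0 < f.leadingCoeff) :
    ∀ᶠ t : ℝ in Filter.atTop, 0 < (-1) ^ f.natDegree * f.eval (-t) := by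
  set g : Polynomial ℝ := C ((-1) ^ f.natDegree) * f.comp (-X) with hg
  have hnegX : (-X : Polynomial ℝ).natDegree = 1 := by simp
  have hunit : ((-1 : ℝ)) ^ f.natDegree ≠ 0 := by simp
  have hgdeg : g.natDegree = f.natDegree := by
    rw [hg, natDegree_C_mul hunit, natDegree_comp, hnegX, mul_one]
  have hglead : g.leadingCoeff = f.leadingCoeff := by
    rw [hg, leadingCoeff_mul, leadingCoeff_C, leadingCoeff_comp (by rw [hnegX]; exact one_ne_zero),
      leadingCoeff_neg, leadingCoeff_X, mul_left_comm, ← mul_pow]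
    simp
  have htend := g.tendsto_atTop_of_leadingCoeff_nonneg
    (natDegree_pos_iff_degree_pos.mp (hgdeg ▸ hdeg)) (hglead ▸ hlead.le)
  filter_upwards [htend.eventually_gt_atTop 0] with t ht
  simpa [hg] using ht

/-- If the roots of `C(G_{n,p},x)` are `-a 0 > … > -a (n - 1)`, separated by a factor `p`, then
`C(G_{n+1,p},x)` has a root `-b` with `a (j - 1) / p < b < a j` for every `j ≤ n`, where the
lower bound is `0` for `j = 0` and there is no upper bound for `j = n`. -/
theorem exists_root_randCliquePoly_succ {n : ℕ} {p : ℝ} (hp0 : 0 < p) (hp1 : p < 1)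
    {a : ℕ → ℝ} (hpos : ∀ i < n, 0 < a i) (hsep : ∀ i, i + 1 < n → a i < p * a (i + 1))
    (hfac : randCliquePoly n p = Polynomial.C (p ^ (n * (n - 1) / 2)) *
      ∏ i ∈ Finset.range n, (Polynomial.X + Polynomial.C (a i)))
    {j : ℕ} (hj : j ≤ n) :
    ∃ b : ℝ, 0 < b ∧ (∀ i, i + 1 = j → a i < p * b) ∧ (j < n → b < a j) ∧
      (randCliquePoly (n + 1) p).eval (-b) = 0 := by
  have hmono : ∀ {i k}, i < k → k < n → a i < a k := fun hik hk =>
    lt_of_forall_lt_mul_succ hp1 hpos hsep hik hk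
  have hmono' : ∀ {i k}, i ≤ k → k < n → a i ≤ a k := fun hik hk =>
    hik.eq_or_lt.elim (fun h => h ▸ le_rfl) fun h => (hmono h hk).le
  have hrec : ∀ t, (randCliquePoly (n + 1) p).eval (-t) =
      (randCliquePoly n p).eval (-t) - t * (randCliquePoly n p).eval (-(p * t)) := by
    intro t
    rw [eval_randCliquePoly_succ, mul_neg]
    ring
  have hzero : ∀ i < n, (randCliquePoly n p).eval (-a i) = 0 := by
    intro i hi
    rw [hfac, Polynomial.eval_mul, Polynomial.eval_prod,
      Finset.prod_eq_zero (Finset.mem_range.mpr hi) (by simp), mul_zero]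
  have hsign : ∀ {t : ℝ} {k : ℕ}, k ≤ n → (∀ i < k, a i < t) → (∀ i, k ≤ i → i < n → t < a i) →
      0 < (-1) ^ k * (randCliquePoly n p).eval (-t) := by
    intro t k hk hlt hgt
    have h := mul_pos (pow_pos hp0 (n * (n - 1) / 2)) (neg_one_pow_mul_prod_sub_pos hk hlt hgt)
    rw [hfac, Polynomial.eval_mul, Polynomial.eval_prod, mul_left_comm]
    simpa [neg_add_eq_sub] using h
  obtain ⟨l, hl0, hla, hlj, hl⟩ : ∃ l : ℝ, 0 ≤ l ∧ (∀ i, i + 1 = j → a i ≤ p * l) ∧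
      (j < n → l < a j) ∧ 0 < (-1) ^ j * (randCliquePoly (n + 1) p).eval (-l) := by
    rcases j with _ | k
    · exact ⟨0, le_rfl, by simp, hpos 0, by simp [eval_zero_randCliquePoly]⟩
    · have hk : 0 < a k := hpos k hj
      have hpl : p * (a k / p) = a k := by field_simp
      have hnext : ∀ i, k + 1 ≤ i → i < n → a k / p < a i := fun i hki hi => by
        rw [div_lt_iff₀' hp0]
        exact (hsep k (hki.trans_lt hi)).trans_le
          (mul_le_mul_of_nonneg_left (hmono' hki hi) hp0.le)
      refine ⟨a k / p, by positivity, fun i hi => ?_, hnext _ le_rfl, ?_⟩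
      · rw [hpl, Nat.succ_injective hi]
      · rw [hrec, hpl, hzero k hj, mul_zero, sub_zero]
        refine hsign hj (fun i hi => (hmono' (Nat.lt_succ_iff.mp hi) hj).trans_lt ?_) hnext
        rw [lt_div_iff₀ hp0]
        nlinarith
  obtain ⟨u, hlu, huj, hu⟩ : ∃ u : ℝ, l < u ∧ (j < n → u = a j) ∧
      (-1) ^ j * (randCliquePoly (n + 1) p).eval (-u) < 0 := by
    rcases hj.lt_or_eq with hjn | rfl
    · have haj : 0 < a j := hpos j hjn
      have hlt : p * a j < a j := by nlinarith
      refine ⟨a j, hlj hjn, fun _ => rfl, ?_⟩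
      have h := hsign (t := p * a j) hj
        (fun i hi => (hmono' (Nat.le_sub_one_of_lt hi) (by omega)).trans_lt ?_)
        (fun i hji hi => hlt.trans_le (hmono' hji hi))
      · rw [hrec, hzero j hjn]
        nlinarith [mul_pos haj h]
      · have h := hsep (j - 1) (by omega)
        rwa [Nat.sub_add_cancel (by omega)] at h
    · have h := Polynomial.eventually_neg_one_pow_mul_eval_neg_pos
        (f := randCliquePoly (j + 1) p) (by rw [natDegree_randCliquePoly _ hp0]; omega)
        (by rw [leadingCoeff_randCliquePoly _ hp0]; positivity)
      rw [natDegree_randCliquePoly _ hp0] at h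
      obtain ⟨u, hu, hlu⟩ := (h.and (Filter.eventually_gt_atTop l)).exists
      refine ⟨u, hlu, fun hjj => absurd hjj (lt_irrefl _), ?_⟩
      rw [pow_succ] at hu
      linarith
  have hcont : ContinuousOn (fun t => (-1) ^ j * (randCliquePoly (n + 1) p).eval (-t))
      (Set.Icc l u) := by fun_prop
  obtain ⟨b, ⟨hlb, hbu⟩, hb⟩ := intermediate_value_Ioo' hlu.le hcont ⟨hu, hl⟩
  refine ⟨b, hl0.trans_lt hlb, fun i hi => (hla i hi).trans_lt (mul_lt_mul_of_pos_left hlb hp0),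
    fun hjn => huj hjn ▸ hbu, ?_⟩
  simpa using hb

theorem exists_separated_roots_randCliquePoly (n : ℕ) {p : ℝ} (hp0 : 0 < p) (hp1 : p < 1) :
    ∃ a : ℕ → ℝ, (∀ i < n, 0 < a i) ∧ (∀ i, i + 1 < n → a i < p * a (i + 1)) ∧
      randCliquePoly n p = Polynomial.C (p ^ (n * (n - 1) / 2)) *
        ∏ i ∈ Finset.range n, (Polynomial.X + Polynomial.C (a i)) := by
  induction n with
  | zero => exact ⟨0, by simp, by simp, by simp [randCliquePoly]⟩
  | succ n ih =>
    obtain ⟨a, hpos, hsep, hfac⟩ := ih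
    choose! b hb0 hab hba hroot using fun j (hj : j ≤ n) =>
      exists_root_randCliquePoly_succ hp0 hp1 hpos hsep hfac hj
    have hbpos : ∀ i < n + 1, 0 < b i := fun i hi => hb0 i (by omega)
    have hbsep : ∀ i, i + 1 < n + 1 → b i < p * b (i + 1) := fun i hi =>
      (hba i (by omega) (by omega)).trans (hab (i + 1) (by omega) i rfl)
    refine ⟨b, hbpos, hbsep, ?_⟩
    have hmono : StrictMonoOn b (Finset.range (n + 1)) := fun i _ j hj hij =>
      lt_of_forall_lt_mul_succ hp1 hbpos hbsep hij (by simpa using hj)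
    have hne : randCliquePoly (n + 1) p ≠ 0 := fun h => by
      simpa [h] using eval_zero_randCliquePoly (n + 1) p
    have h := Polynomial.eq_C_leadingCoeff_mul_prod_X_add_C
      (natDegree_randCliquePoly (n + 1) hp0) hne hmono.injOn fun i hi => hroot i (by omega)
    rwa [leadingCoeff_randCliquePoly _ hp0] at h

/-- For `p ∈ (0,1)`, all roots of `C(G_{n,p},x)` are real, simple and negative:
`C(G_{n,p},x) = p^{n(n-1)/2} ∏_{i} (x - r_i)` with `r_0 < r_1 < … < r_{n-1} < 0`,
and moreover `p · r_i < r_{i+1}` for consecutive roots (in ascending order the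
smaller root, multiplied by `p`, stays below the larger one). -/
theorem stmt_9 (n : ℕ) (hn : 1 ≤ n) (p : ℝ) (hp0 : 0 < p) (hp1 : p < 1) :
    ∃ r : Fin n → ℝ, StrictMono r ∧ (∀ i, r i < 0) ∧
      randCliquePoly n p
        = Polynomial.C (p ^ (n * (n - 1) / 2)) *
            ∏ i : Fin n, (Polynomial.X - Polynomial.C (r i)) ∧
      ∀ i : Fin n, ∀ h : (i : ℕ) + 1 < n, p * r i < r ⟨(i : ℕ) + 1, h⟩ := by
  obtain ⟨a, hpos, hsep, hfac⟩ := exists_separated_roots_randCliquePoly n hp0 hp1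
  refine ⟨fun i => -a (n - 1 - i), fun i j hij => ?_, fun i => ?_, ?_, fun i hi => ?_⟩
  · have hij : (i : ℕ) < j := hij
    exact neg_lt_neg (lt_of_forall_lt_mul_succ hp1 hpos hsep (by omega) (by omega))
  · exact neg_neg_of_pos (hpos _ (by omega))
  · rw [hfac, Fin.prod_univ_eq_prod_range
      (fun i => Polynomial.X - Polynomial.C (-a (n - 1 - i))) n,
      ← Finset.prod_range_reflect]
    simp
  · have h := hsep (n - 1 - (i + 1)) (by omega)
    rw [show n - 1 - ((i : ℕ) + 1) + 1 = n - 1 - i by omega] at h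
    simpa using h
end
end
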